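/- For every r ≥ 2 and α ∈ [0,1] there exists a constant C > 0 such that for every Schwartz function u₀ on ℝ and every t ≠ 0, ‖D^{α(1−2/r)} e^{it∂_x⁴} u₀‖_{L^r(ℝ)} ≤ C |t|^{-((1+α)/4)(1−2/r)} ‖u₀‖_{L^{r'}(ℝ)}, where 1/r + 1/r' = 1. -/

import Mathlib

open MeasureTheory Complex
open scoped ENNReal

/-- The Fourier transform `û(ξ) = ∫ e^{-ixξ} u(x) dx`. -/
noncomputable def fourierInt (u : ℝ → ℂ) (ξ : ℝ) : ℂ :=
  ∫ x : ℝ, Complex.exp (-(Complex.I * x * ξ)) * u x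

/-- `(D^β e^{it∂_x⁴} u)(x) = (2π)⁻¹ ∫ |ξ|^β e^{i(xξ+tξ⁴)} û(ξ) dξ`. -/
noncomputable def DbihamGroup (β t : ℝ) (u : ℝ → ℂ) (x : ℝ) : ℂ :=
  (2 * Real.pi)⁻¹ * ∫ ξ : ℝ, ((|ξ| ^ β : ℝ) : ℂ) *
    Complex.exp (Complex.I * (x * ξ + t * ξ^4)) * fourierInt u ξ

/-- Non-stationary phase: one integration by parts, with the remainder dominated by the
derivative `h` of an explicit function `H`. -/
theorem norm_oscillatory_integral_le {A A' : ℝ → ℂ} {φ p q h H : ℝ → ℝ} {a b : ℝ} (hab : a ≤ b)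
    (hA : ∀ ξ ∈ Set.Icc a b, HasDerivAt A (A' ξ) ξ) (hA' : ContinuousOn A' (Set.Icc a b))
    (hφ : ∀ ξ ∈ Set.Icc a b, HasDerivAt φ (p ξ) ξ) (hp : ∀ ξ ∈ Set.Icc a b, HasDerivAt p (q ξ) ξ)
    (hq : ContinuousOn q (Set.Icc a b)) (hp0 : ∀ ξ ∈ Set.Icc a b, p ξ ≠ 0)
    (hH : ∀ ξ ∈ Set.Icc a b, HasDerivAt H (h ξ) ξ) (hh : ContinuousOn h (Set.Icc a b))
    (hbd : ∀ ξ ∈ Set.Icc a b, ‖A' ξ‖ / |p ξ| + ‖A ξ‖ * |q ξ| / p ξ ^ 2 ≤ h ξ) :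
    ‖∫ ξ in a..b, A ξ * cexp (I * (φ ξ : ℂ))‖ ≤
      ‖A a‖ / |p a| + ‖A b‖ / |p b| + (H b - H a) := by
  have hI : Set.uIcc a b = Set.Icc a b := Set.uIcc_of_le hab
  have hpc : ContinuousOn p (Set.Icc a b) := fun ξ hξ => (hp ξ hξ).continuousAt.continuousWithinAt
  have hAc : ContinuousOn A (Set.Icc a b) := fun ξ hξ => (hA ξ hξ).continuousAt.continuousWithinAt
  have hφc : ContinuousOn φ (Set.Icc a b) := fun ξ hξ => (hφ ξ hξ).continuousAt.continuousWithinAt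
  have hpC : ∀ ξ ∈ Set.Icc a b, (I * (p ξ : ℂ)) ≠ 0 := fun ξ hξ =>
    mul_ne_zero I_ne_zero (by exact_mod_cast hp0 ξ hξ)
  set u : ℝ → ℂ := fun ξ => A ξ / (I * (p ξ : ℂ)) with hu
  set u' : ℝ → ℂ := fun ξ => (A' ξ * (I * (p ξ : ℂ)) - A ξ * (I * (q ξ : ℂ))) /
    (I * (p ξ : ℂ)) ^ 2 with hu'
  set v : ℝ → ℂ := fun ξ => cexp (I * (φ ξ : ℂ)) with hv
  set v' : ℝ → ℂ := fun ξ => cexp (I * (φ ξ : ℂ)) * (I * (p ξ : ℂ)) with hv'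
  have hvn : ∀ ξ, ‖v ξ‖ = 1 := fun ξ => by
    simp only [hv]; rw [mul_comm]; exact norm_exp_ofReal_mul_I _
  have hud : ∀ ξ ∈ Set.Icc a b, HasDerivAt u (u' ξ) ξ := fun ξ hξ =>
    (hA ξ hξ).div ((hp ξ hξ).ofReal_comp.const_mul I) (hpC ξ hξ)
  have hvd : ∀ ξ ∈ Set.Icc a b, HasDerivAt v (v' ξ) ξ := fun ξ hξ =>
    ((hφ ξ hξ).ofReal_comp.const_mul I).cexp
  have hu'c : ContinuousOn u' (Set.Icc a b) := by
    refine ContinuousOn.div ?_ ?_ fun ξ hξ => pow_ne_zero 2 (hpC ξ hξ)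
    · fun_prop
    · fun_prop
  have hv'c : ContinuousOn v' (Set.Icc a b) := by fun_prop
  have key := intervalIntegral.integral_mul_deriv_eq_deriv_mul (a := a) (b := b)
    (u := u) (v := v) (u' := u') (v' := v') (by rwa [hI]) (by rwa [hI])
    (ContinuousOn.intervalIntegrable (by rwa [hI])) (ContinuousOn.intervalIntegrable (by rwa [hI]))
  have e1 : ∫ ξ in a..b, A ξ * cexp (I * (φ ξ : ℂ)) = ∫ ξ in a..b, u ξ * v' ξ := by
    refine intervalIntegral.integral_congr fun ξ hξ => ?_
    rw [hI] at hξ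
    simp only [hu, hv']
    rw [← mul_assoc, mul_right_comm, div_mul_cancel₀ _ (hpC ξ hξ)]
  have hun : ∀ ξ, ‖u ξ * v ξ‖ = ‖A ξ‖ / |p ξ| := fun ξ => by
    rw [norm_mul, hvn, hu]; simp
  have e2 : ‖∫ ξ in a..b, u' ξ * v ξ‖ ≤ ∫ ξ in a..b, h ξ := by
    refine intervalIntegral.norm_integral_le_of_norm_le hab (ae_of_all _ fun ξ hξ => ?_)
      (ContinuousOn.intervalIntegrable (by rwa [hI]))
    have hξ' := Set.Ioc_subset_Icc_self hξ
    refine le_trans ?_ (hbd ξ hξ')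
    rw [norm_mul, hvn, mul_one, hu']
    simp only [norm_div, norm_pow, norm_mul, norm_I, one_mul, norm_real, Real.norm_eq_abs, sq_abs]
    have hpp : 0 < |p ξ| := abs_pos.2 (hp0 ξ hξ')
    calc _ ≤ (‖A' ξ‖ * |p ξ| + ‖A ξ‖ * |q ξ|) / p ξ ^ 2 := by
          gcongr
          refine (norm_sub_le _ _).trans_eq ?_
          simp
      _ = _ := by rw [← sq_abs (p ξ)]; field_simp
  have e3 : ∫ ξ in a..b, h ξ = H b - H a :=
    intervalIntegral.integral_eq_sub_of_hasDerivAt (by rwa [hI])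
      (ContinuousOn.intervalIntegrable (by rwa [hI]))
  rw [e1, key]
  calc _ ≤ ‖u b * v b‖ + ‖u a * v a‖ + ‖∫ ξ in a..b, u' ξ * v ξ‖ :=
        (norm_sub_le _ _).trans (add_le_add_left (norm_sub_le _ _) _)
    _ ≤ _ := by rw [hun, hun]; linarith

theorem norm_integral_glue {f : ℝ → ℂ} {l c u C₁ C₂ : ℝ} (hC₁ : 0 ≤ C₁) (hC₂ : 0 ≤ C₂)
    (hf : ∀ a b, 1 ≤ a → a ≤ b → IntervalIntegrable f volume a b)
    (h₁ : ∀ a b, 1 ≤ a → l ≤ a → a ≤ b → b ≤ c → ‖∫ ξ in a..b, f ξ‖ ≤ C₁)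
    (h₂ : ∀ a b, 1 ≤ a → c ≤ a → a ≤ b → b ≤ u → ‖∫ ξ in a..b, f ξ‖ ≤ C₂) :
    ∀ a b, 1 ≤ a → l ≤ a → a ≤ b → b ≤ u → ‖∫ ξ in a..b, f ξ‖ ≤ C₁ + C₂ := by
  intro a b h1 hla hab hbu
  rcases le_total c a with hc | hc
  · linarith [h₂ a b h1 hc hab hbu]
  rcases le_total b c with hb | hb
  · linarith [h₁ a b h1 hla hab hb]
  rw [← intervalIntegral.integral_add_adjacent_intervals (hf a c h1 hc)
    (hf c b (h1.trans hc) hb)]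
  exact (norm_add_le _ _).trans
    (add_le_add (h₁ a c h1 hla hc le_rfl) (h₂ c b (h1.trans hc) le_rfl hb hbu))

section Quartic

variable {A A' : ℝ → ℂ} {G s : ℝ}

theorem hasDerivAt_quartic_phase (s ξ : ℝ) :
    HasDerivAt (fun ξ : ℝ => -(4 * s ^ 3) * ξ + ξ ^ 4) (4 * (ξ ^ 3 - s ^ 3)) ξ := by
  exact (((hasDerivAt_id ξ).const_mul (-(4 * s ^ 3))).add (hasDerivAt_pow 4 ξ)).congr_deriv
    (by norm_num; ring)

theorem hasDerivAt_quartic_phase_deriv (s ξ : ℝ) :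
    HasDerivAt (fun ξ : ℝ => 4 * (ξ ^ 3 - s ^ 3)) (12 * ξ ^ 2) ξ := by
  exact (((hasDerivAt_pow 3 ξ).sub_const (s ^ 3)).const_mul 4).congr_deriv (by norm_num; ring)

theorem norm_quartic_far_le (hA : ∀ ξ, 1 ≤ ξ → HasDerivAt A (A' ξ) ξ)
    (hA' : ContinuousOn A' (Set.Ici 1)) (hAb : ∀ ξ, 1 ≤ ξ → ‖A ξ‖ ≤ ξ)
    (hAb' : ∀ ξ, 1 ≤ ξ → ‖A' ξ‖ ≤ G) {a b : ℝ} (ha : 1 ≤ a) (hab : a ≤ b)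
    (hfar : ∀ ξ ∈ Set.Icc a b, 3 * ξ ^ 3 ≤ |4 * (ξ ^ 3 - s ^ 3)|) :
    ‖∫ ξ in a..b, A ξ * cexp (I * ((-(4 * s ^ 3) * ξ + ξ ^ 4 : ℝ) : ℂ))‖ ≤ G + 3 := by
  have hG : 0 ≤ G := (norm_nonneg _).trans (hAb' 1 le_rfl)
  have hpos : ∀ ξ ∈ Set.Icc a b, 1 ≤ ξ := fun ξ hξ => ha.trans hξ.1
  have := norm_oscillatory_integral_le (A := A) (A' := A')
    (φ := fun ξ => -(4 * s ^ 3) * ξ + ξ ^ 4) (p := fun ξ => 4 * (ξ ^ 3 - s ^ 3))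
    (q := fun ξ => 12 * ξ ^ 2) (h := fun ξ => (G + 2) * (ξ ^ 2)⁻¹)
    (H := fun ξ => (G + 2) * (-ξ⁻¹)) hab (fun ξ hξ => hA ξ (hpos ξ hξ))
    (hA'.mono fun ξ hξ => hpos ξ hξ) (fun ξ _ => hasDerivAt_quartic_phase s ξ)
    (fun ξ _ => hasDerivAt_quartic_phase_deriv s ξ) (by fun_prop)
    (fun ξ hξ => by
      have h1 := hpos ξ hξ
      have h2 := hfar ξ hξ
      exact abs_pos.1 (lt_of_lt_of_le (by positivity) h2))
    (fun ξ hξ => by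
      have h1 := hpos ξ hξ
      simpa using ((hasDerivAt_inv (by positivity : ξ ≠ 0)).neg).const_mul (G + 2))
    (ContinuousOn.mul (by fun_prop) (ContinuousOn.inv₀ (by fun_prop) fun ξ hξ => by
      have h1 := hpos ξ hξ
      positivity))
    (fun ξ hξ => by
      have h1 := hpos ξ hξ
      have h2 := hfar ξ hξ
      have hA1 := hAb ξ h1
      have hA2 := hAb' ξ h1
      rw [← sq_abs (4 * (ξ ^ 3 - s ^ 3)), abs_of_nonneg (by positivity : 0 ≤ 12 * ξ ^ 2)]
      calc _ ≤ G / (3 * ξ ^ 3) + ξ * (12 * ξ ^ 2) / (3 * ξ ^ 3) ^ 2 := by gcongr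
        _ = (G / 3 + 4 / 3) * (ξ ^ 2)⁻¹ * ξ⁻¹ := by field_simp; ring
        _ ≤ (G / 3 + 4 / 3) * (ξ ^ 2)⁻¹ * 1 := by
          gcongr
          exact inv_le_one_of_one_le₀ h1
        _ ≤ (G + 2) * (ξ ^ 2)⁻¹ := by
          rw [mul_one]; gcongr <;> linarith)
  refine this.trans ?_
  have bdry : ∀ ξ ∈ Set.Icc a b, ‖A ξ‖ / |4 * (ξ ^ 3 - s ^ 3)| ≤ 1 / 2 := fun ξ hξ => by
    have h1 := hpos ξ hξ
    have h2 := hfar ξ hξ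
    have hA1 := hAb ξ h1
    calc _ ≤ ξ / (3 * ξ ^ 3) := by gcongr
      _ ≤ 1 / 2 := by
        rw [div_le_div_iff₀ (by positivity) (by positivity)]
        nlinarith [one_le_pow₀ (n := 2) h1]
  have b1 := bdry a ⟨le_rfl, hab⟩
  have b2 := bdry b ⟨hab, le_rfl⟩
  have h3 : a⁻¹ ≤ 1 := inv_le_one_of_one_le₀ ha
  have h4 : 0 < b⁻¹ := by
    have := ha.trans hab
    positivity
  have h5 : (G + 2) * a⁻¹ ≤ G + 2 := mul_le_of_le_one_right (by linarith) h3
  have h6 : 0 ≤ (G + 2) * b⁻¹ := by positivity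
  linarith

theorem norm_quartic_near_le (hA : ∀ ξ, 1 ≤ ξ → HasDerivAt A (A' ξ) ξ)
    (hA' : ContinuousOn A' (Set.Ici 1)) (hAb : ∀ ξ, 1 ≤ ξ → ‖A ξ‖ ≤ ξ)
    (hAb' : ∀ ξ, 1 ≤ ξ → ‖A' ξ‖ ≤ G) {a b : ℝ} (ha : 1 ≤ a) (hab : a ≤ b) (hs : 0 < s)
    (hb : b ≤ 2 * s) (hnear : s + s⁻¹ ≤ a ∨ b ≤ s - s⁻¹) :
    ‖∫ ξ in a..b, A ξ * cexp (I * ((-(4 * s ^ 3) * ξ + ξ ^ 4 : ℝ) : ℂ))‖ ≤ G + 7 := by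
  have hG : 0 ≤ G := (norm_nonneg _).trans (hAb' 1 le_rfl)
  have hpos : ∀ ξ ∈ Set.Icc a b, 1 ≤ ξ := fun ξ hξ => ha.trans hξ.1
  have hle : ∀ ξ ∈ Set.Icc a b, ξ ≤ 2 * s := fun ξ hξ => hξ.2.trans hb
  have hdist : ∀ ξ ∈ Set.Icc a b, s⁻¹ ≤ |ξ - s| := fun ξ hξ => by
    rcases hnear with h | h
    · exact le_trans (by linarith [hξ.1]) (le_abs_self _)
    · exact le_trans (by linarith [hξ.2]) (neg_le_abs _)
  have hsi : 0 < s⁻¹ := by positivity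
  have hp : ∀ ξ ∈ Set.Icc a b, 4 * s ^ 2 * |ξ - s| ≤ |4 * (ξ ^ 3 - s ^ 3)| := fun ξ hξ => by
    have h1 := hpos ξ hξ
    have : 4 * (ξ ^ 3 - s ^ 3) = (4 * (ξ ^ 2 + ξ * s + s ^ 2)) * (ξ - s) := by ring
    rw [this, abs_mul, abs_of_nonneg (by positivity : 0 ≤ 4 * (ξ ^ 2 + ξ * s + s ^ 2))]
    gcongr
    nlinarith [mul_pos (by positivity : 0 < ξ) hs, sq_nonneg ξ]
  have hp' : ∀ ξ ∈ Set.Icc a b, 4 * s ≤ |4 * (ξ ^ 3 - s ^ 3)| := fun ξ hξ => by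
    refine le_trans ?_ (hp ξ hξ)
    calc 4 * s = 4 * s ^ 2 * s⁻¹ := by field_simp
      _ ≤ _ := by gcongr; exact hdist ξ hξ
  have hne : ∀ ξ ∈ Set.Icc a b, ξ - s ≠ 0 := fun ξ hξ =>
    abs_pos.1 (lt_of_lt_of_le hsi (hdist ξ hξ))
  have := norm_oscillatory_integral_le (A := A) (A' := A')
    (φ := fun ξ => -(4 * s ^ 3) * ξ + ξ ^ 4) (p := fun ξ => 4 * (ξ ^ 3 - s ^ 3))
    (q := fun ξ => 12 * ξ ^ 2) (h := fun ξ => G / (4 * s) * 1 + 6 / s * ((ξ - s) ^ 2)⁻¹)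
    (H := fun ξ => G / (4 * s) * ξ + 6 / s * (-(ξ - s)⁻¹)) hab
    (fun ξ hξ => hA ξ (hpos ξ hξ))
    (hA'.mono fun ξ hξ => hpos ξ hξ) (fun ξ _ => hasDerivAt_quartic_phase s ξ)
    (fun ξ _ => hasDerivAt_quartic_phase_deriv s ξ) (by fun_prop)
    (fun ξ hξ => abs_pos.1 (lt_of_lt_of_le (by positivity) (hp' ξ hξ)))
    (fun ξ hξ => by
      have h1 := (((hasDerivAt_id ξ).sub_const s).inv (hne ξ hξ)).neg.const_mul (6 / s)
      exact (((hasDerivAt_id ξ).const_mul (G / (4 * s))).add h1).congr_deriv (by simp [neg_div]))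
    (ContinuousOn.add (by fun_prop) (ContinuousOn.mul (by fun_prop)
      (ContinuousOn.inv₀ (by fun_prop) fun ξ hξ => pow_ne_zero 2 (hne ξ hξ))))
    (fun ξ hξ => by
      have h1 := hpos ξ hξ
      have hA1 := (hAb ξ h1).trans (hle ξ hξ)
      have hA2 := hAb' ξ h1
      have h3 := abs_pos.2 (hne ξ hξ)
      rw [← sq_abs (4 * (ξ ^ 3 - s ^ 3)), abs_of_nonneg (by positivity : 0 ≤ 12 * ξ ^ 2),
        ← sq_abs (ξ - s)]
      calc _ ≤ G / (4 * s) + 2 * s * (12 * (2 * s) ^ 2) / (4 * s ^ 2 * |ξ - s|) ^ 2 := by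
            gcongr
            · exact hp' ξ hξ
            · exact hle ξ hξ
            · exact hp ξ hξ
        _ = _ := by field_simp; ring)
  refine this.trans ?_
  have bdry : ∀ ξ ∈ Set.Icc a b, ‖A ξ‖ / |4 * (ξ ^ 3 - s ^ 3)| ≤ 1 / 2 := fun ξ hξ => by
    have hA1 := (hAb ξ (hpos ξ hξ)).trans (hle ξ hξ)
    have := hp' ξ hξ
    calc _ ≤ 2 * s / (4 * s) := by gcongr
      _ = 1 / 2 := by field_simp; norm_num
  have b1 := bdry a ⟨le_rfl, hab⟩
  have b2 := bdry b ⟨hab, le_rfl⟩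
  have h4 : G / (4 * s) * b - G / (4 * s) * a ≤ G := by
    rw [← mul_sub]
    calc _ ≤ G / (4 * s) * (2 * s) := by gcongr; linarith
      _ = G / 2 := by field_simp; norm_num
      _ ≤ G := by linarith
  have h5 : 6 / s * (-(b - s)⁻¹) - 6 / s * (-(a - s)⁻¹) ≤ 6 := by
    have e : 6 / s * (-(b - s)⁻¹) - 6 / s * (-(a - s)⁻¹) =
      6 / s * ((a - s)⁻¹ - (b - s)⁻¹) := by ring
    rw [e]
    calc _ ≤ 6 / s * s := by
          gcongr
          rcases hnear with h | h
          · have h1 : (a - s)⁻¹ ≤ s := inv_le_of_inv_le₀ hs (by linarith)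
            have h2 : 0 ≤ (b - s)⁻¹ := inv_nonneg.2 (by linarith)
            linarith
          · have h1 : (s - b)⁻¹ ≤ s := inv_le_of_inv_le₀ hs (by linarith)
            have h2 : 0 ≤ (s - a)⁻¹ := inv_nonneg.2 (by linarith)
            rw [← neg_sub s a, ← neg_sub s b, inv_neg, inv_neg]
            linarith
      _ = 6 := by field_simp
  linarith

theorem norm_quartic_integral_le (hA : ∀ ξ, 1 ≤ ξ → HasDerivAt A (A' ξ) ξ)
    (hA' : ContinuousOn A' (Set.Ici 1)) (hAb : ∀ ξ, 1 ≤ ξ → ‖A ξ‖ ≤ ξ)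
    (hAb' : ∀ ξ, 1 ≤ ξ → ‖A' ξ‖ ≤ G) (s : ℝ) {R : ℝ} (hR : 1 ≤ R) :
    ‖∫ ξ in (1 : ℝ)..R, A ξ * cexp (I * ((-(4 * s ^ 3) * ξ + ξ ^ 4 : ℝ) : ℂ))‖ ≤
      4 * G + 30 := by
  have hG : 0 ≤ G := (norm_nonneg _).trans (hAb' 1 le_rfl)
  have hAc : ContinuousOn A (Set.Ici 1) := fun ξ hξ => (hA ξ hξ).continuousAt.continuousWithinAt
  have hfint : ∀ a b : ℝ, 1 ≤ a → a ≤ b → IntervalIntegrable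
      (fun ξ => A ξ * cexp (I * ((-(4 * s ^ 3) * ξ + ξ ^ 4 : ℝ) : ℂ))) volume a b := by
    intro a b ha hab
    refine ContinuousOn.intervalIntegrable ?_
    rw [Set.uIcc_of_le hab]
    refine ContinuousOn.mul (hAc.mono fun ξ hξ => ha.trans hξ.1) ?_
    fun_prop
  rcases le_total s (1 / 2) with hs | hs
  · refine (norm_quartic_far_le hA hA' hAb hAb' le_rfl hR fun ξ hξ => ?_).trans (by linarith)
    refine le_trans ?_ (le_abs_self _)
    have h1 : s ≤ ξ / 2 := by linarith [hξ.1]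
    have h2 : s ^ 3 ≤ (ξ / 2) ^ 3 := by
      exact (Odd.strictMono_pow (by decide : Odd 3)).monotone h1
    have h3 : 0 ≤ ξ ^ 3 := pow_nonneg (by linarith [hξ.1]) 3
    nlinarith
  have hs0 : 0 < s := by linarith
  have far₁ : ∀ a b, 1 ≤ a → 1 ≤ a → a ≤ b → b ≤ s / 2 → _ := fun a b ha _ hab hb =>
    norm_quartic_far_le (s := s) hA hA' hAb hAb' ha hab fun ξ hξ => by
      refine le_trans ?_ (neg_le_abs _)
      have h0 : 0 ≤ ξ := by linarith [hξ.1]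
      have h1 : ξ ≤ s / 2 := by linarith [hξ.2]
      have h2 : ξ ^ 3 ≤ (s / 2) ^ 3 := pow_le_pow_left₀ h0 h1 3
      have h3 : 0 ≤ ξ ^ 3 := pow_nonneg h0 3
      nlinarith
  have far₂ : ∀ a b, 1 ≤ a → 2 * s ≤ a → a ≤ b → b ≤ R → _ := fun a b ha hla hab hb =>
    norm_quartic_far_le (s := s) hA hA' hAb hAb' ha hab fun ξ hξ => by
      refine le_trans ?_ (le_abs_self _)
      have h1 : s ≤ ξ / 2 := by linarith [hξ.1]
      have h2 : s ^ 3 ≤ (ξ / 2) ^ 3 := pow_le_pow_left₀ hs0.le h1 3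
      have h3 : 0 ≤ ξ ^ 3 := pow_nonneg (by linarith [hξ.1]) 3
      nlinarith
  have near₁ : ∀ a b, 1 ≤ a → s / 2 ≤ a → a ≤ b → b ≤ s - s⁻¹ → _ := fun a b ha _ hab hb =>
    norm_quartic_near_le (s := s) hA hA' hAb hAb' ha hab hs0
      (by linarith [inv_pos.2 hs0]) (Or.inr hb)
  have near₂ : ∀ a b, 1 ≤ a → s + s⁻¹ ≤ a → a ≤ b → b ≤ 2 * s → _ := fun a b ha hla hab hb =>
    norm_quartic_near_le (s := s) hA hA' hAb hAb' ha hab hs0 hb (Or.inl hla)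
  have mid : ∀ a b, 1 ≤ a → s - s⁻¹ ≤ a → a ≤ b → b ≤ s + s⁻¹ →
      ‖∫ ξ in a..b, A ξ * cexp (I * ((-(4 * s ^ 3) * ξ + ξ ^ 4 : ℝ) : ℂ))‖ ≤ 10 := by
    intro a b ha hla hab hb
    have hs4 : s⁻¹ ≤ 4 * s := by
      rw [inv_le_iff_one_le_mul₀ hs0]
      nlinarith
    have := intervalIntegral.norm_integral_le_of_norm_le_const (a := a) (b := b) (C := 5 * s)
      (f := fun ξ => A ξ * cexp (I * ((-(4 * s ^ 3) * ξ + ξ ^ 4 : ℝ) : ℂ))) (fun ξ hξ => by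
        rw [Set.uIoc_of_le hab] at hξ
        rw [norm_mul, mul_comm I, norm_exp_ofReal_mul_I, mul_one]
        exact (hAb ξ (by linarith [hξ.1])).trans (by linarith [hξ.2]))
    refine this.trans ?_
    rw [abs_of_nonneg (by linarith)]
    calc 5 * s * (b - a) ≤ 5 * s * (2 * s⁻¹) := by gcongr; linarith
      _ = 10 := by field_simp; norm_num
  have g₁ := norm_integral_glue (by linarith) (by linarith) hfint far₁ near₁
  have g₂ := norm_integral_glue (by linarith) (by norm_num) hfint g₁ mid
  have g₃ := norm_integral_glue (by linarith) (by linarith) hfint g₂ near₂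
  have g₄ := norm_integral_glue (by linarith) (by linarith) hfint g₃ far₂
  exact (g₄ 1 R le_rfl le_rfl hR le_rfl).trans (by linarith)

end Quartic

theorem norm_cexp_mul_log {s : ℂ} {ξ : ℝ} (hξ : 0 < ξ) :
    ‖cexp (s * (Real.log ξ : ℂ))‖ = ξ ^ s.re := by
  rw [norm_exp, re_mul_ofReal, Real.rpow_def_of_pos hξ, mul_comm]

theorem exists_eq_neg_four_mul_cube (x : ℝ) : ∃ c : ℝ, x = -(4 * c ^ 3) := by
  have key : ∀ y : ℝ, 0 ≤ y → ∃ c : ℝ, y = 4 * c ^ 3 := fun y hy => by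
    refine ⟨(y / 4) ^ ((1 : ℝ) / 3), ?_⟩
    rw [← Real.rpow_natCast, ← Real.rpow_mul (by positivity)]
    norm_num
    ring
  rcases le_total 0 x with h | h
  · obtain ⟨c, hc⟩ := key x h
    exact ⟨-c, by rw [hc]; ring⟩
  · obtain ⟨c, hc⟩ := key (-x) (by linarith)
    exact ⟨c, by linarith⟩

/-- The truncated half-line kernel of `D^s e^{i∂_x⁴}` is bounded. -/
theorem norm_unit_kernel_le {s : ℂ} (h0 : 0 ≤ s.re) (h1 : s.re ≤ 1) (x : ℝ) {R : ℝ}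
    (hR : 0 ≤ R) :
    ‖∫ ξ in (0 : ℝ)..R, cexp (s * (Real.log ξ : ℂ)) * cexp (I * ((x * ξ + ξ ^ 4 : ℝ) : ℂ))‖ ≤
      4 * ‖s‖ + 31 := by
  obtain ⟨c, rfl⟩ := exists_eq_neg_four_mul_cube x
  set f : ℝ → ℂ := fun ξ =>
    cexp (s * (Real.log ξ : ℂ)) * cexp (I * ((-(4 * c ^ 3) * ξ + ξ ^ 4 : ℝ) : ℂ)) with hf
  have hfm : Measurable f := by fun_prop
  have hfn : ∀ ξ, 0 < ξ → ‖f ξ‖ = ξ ^ s.re := fun ξ hξ => by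
    rw [hf, norm_mul, mul_comm I, norm_exp_ofReal_mul_I, mul_one, norm_cexp_mul_log hξ]
  have small : ∀ r, 0 ≤ r → r ≤ 1 → ‖∫ ξ in (0 : ℝ)..r, f ξ‖ ≤ 1 := fun r hr hr1 => by
    have := intervalIntegral.norm_integral_le_of_norm_le_const (a := 0) (b := r) (C := 1)
      (f := f) (fun ξ hξ => by
        rw [Set.uIoc_of_le hr] at hξ
        rw [hfn ξ hξ.1]
        exact Real.rpow_le_one hξ.1.le (hξ.2.trans hr1) h0)
    refine this.trans ?_
    rw [sub_zero, abs_of_nonneg hr]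
    linarith
  rcases le_total R 1 with hR1 | hR1
  · exact (small R hR hR1).trans (by linarith [norm_nonneg s])
  have hfint : ∀ a b : ℝ, 0 ≤ a → a ≤ b → IntervalIntegrable f volume a b := by
    intro a b ha hab
    rw [intervalIntegrable_iff_integrableOn_Ioc_of_le hab]
    refine Measure.integrableOn_of_bounded (M := b ^ s.re) (by simp)
      hfm.aestronglyMeasurable ?_
    refine (ae_restrict_iff' measurableSet_Ioc).2 (ae_of_all _ fun ξ hξ => ?_)
    have h0ξ : 0 < ξ := ha.trans_lt hξ.1
    rw [hfn ξ h0ξ]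
    exact Real.rpow_le_rpow h0ξ.le hξ.2 h0
  rw [← intervalIntegral.integral_add_adjacent_intervals (hfint 0 1 le_rfl zero_le_one)
    (hfint 1 R zero_le_one hR1)]
  have big := norm_quartic_integral_le (A := fun ξ => cexp (s * (Real.log ξ : ℂ)))
    (A' := fun ξ => cexp (s * (Real.log ξ : ℂ)) * (s * ((ξ⁻¹ : ℝ) : ℂ))) (G := ‖s‖)
    (fun ξ hξ => ((Real.hasDerivAt_log (by positivity)).ofReal_comp.const_mul s).cexp)
    (fun ξ hξ => by
      have : ξ ≠ 0 := by
        have : (1 : ℝ) ≤ ξ := hξ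
        positivity
      refine ContinuousAt.continuousWithinAt ?_
      fun_prop (disch := assumption))
    (fun ξ hξ => by
      rw [norm_cexp_mul_log (by positivity)]
      simpa using Real.rpow_le_rpow_of_exponent_le hξ h1)
    (fun ξ hξ => by
      have hξ0 : 0 < ξ := by positivity
      rw [norm_mul, norm_mul, norm_cexp_mul_log hξ0, norm_real, Real.norm_eq_abs,
        abs_of_pos (inv_pos.2 hξ0)]
      have : ξ ^ s.re ≤ ξ := by simpa using Real.rpow_le_rpow_of_exponent_le hξ h1
      calc _ ≤ ξ * (‖s‖ * ξ⁻¹) := by gcongr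
        _ = ‖s‖ := by field_simp)
    c hR1
  calc _ ≤ 1 + (4 * ‖s‖ + 30) :=
        (norm_add_le _ _).trans (add_le_add (small 1 zero_le_one le_rfl) big)
    _ = _ := by ring

theorem norm_unit_kernel_neg_le {s : ℂ} (h0 : 0 ≤ s.re) (h1 : s.re ≤ 1) (x : ℝ) {R : ℝ}
    (hR : 0 ≤ R) :
    ‖∫ ξ in (0 : ℝ)..R, cexp (s * (Real.log ξ : ℂ)) * cexp (I * ((x * ξ + -ξ ^ 4 : ℝ) : ℂ))‖ ≤
      4 * ‖s‖ + 31 := by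
  have := norm_unit_kernel_le (s := starRingEnd ℂ s) (by simpa) (by simpa) (-x) hR
  rw [RCLike.norm_conj] at this
  refine le_of_eq_of_le ?_ this
  rw [intervalIntegral.integral_of_le hR, intervalIntegral.integral_of_le hR,
    ← RCLike.norm_conj, ← integral_conj]
  congr 2
  ext ξ
  rw [map_mul, ← exp_conj, ← exp_conj]
  simp only [map_mul, conj_ofReal, conj_I]
  congr 2
  push_cast
  ring

theorem norm_half_kernel_le {s : ℂ} (h0 : 0 ≤ s.re) (h1 : s.re ≤ 1) (x : ℝ) {t R : ℝ}
    (ht : t ≠ 0) (hR : 0 ≤ R) :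
    ‖∫ ξ in (0 : ℝ)..R, cexp (s * (Real.log ξ : ℂ)) *
        cexp (I * ((x * ξ + t * ξ ^ 4 : ℝ) : ℂ))‖ ≤
      (4 * ‖s‖ + 31) * |t| ^ (-((1 + s.re) / 4)) := by
  have ht' : 0 < |t| := abs_pos.2 ht
  set lam : ℝ := |t| ^ (-(1 / 4) : ℝ) with hlam
  have hl : 0 < lam := Real.rpow_pos_of_pos ht' _
  have hl4 : |t| * lam ^ 4 = 1 := by
    rw [hlam, ← Real.rpow_natCast, ← Real.rpow_mul ht'.le]
    norm_num
    rw [Real.rpow_neg_one, mul_inv_cancel₀ ht'.ne']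
  have hlp : lam * lam ^ s.re = |t| ^ (-((1 + s.re) / 4)) := by
    rw [hlam, ← Real.rpow_mul ht'.le, ← Real.rpow_add ht']
    congr 1; ring
  set f : ℝ → ℂ := fun ξ => cexp (s * (Real.log ξ : ℂ)) *
        cexp (I * ((x * ξ + t * ξ ^ 4 : ℝ) : ℂ)) with hf
  have hRl : 0 ≤ R / lam := by positivity
  have sub : ∫ ξ in (0 : ℝ)..R, f ξ = (lam : ℂ) * ∫ η in (0 : ℝ)..R / lam, f (lam * η) := by
    rw [intervalIntegral.integral_comp_mul_left f hl.ne', mul_zero, mul_div_cancel₀ _ hl.ne',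
      real_smul, ← mul_assoc, ← ofReal_mul, mul_inv_cancel₀ hl.ne', ofReal_one, one_mul]
  have pull : ∫ η in (0 : ℝ)..R / lam, f (lam * η) = cexp (s * (Real.log lam : ℂ)) *
      ∫ η in (0 : ℝ)..R / lam, cexp (s * (Real.log η : ℂ)) *
        cexp (I * ((x * lam * η + t * lam ^ 4 * η ^ 4 : ℝ) : ℂ)) := by
    rw [← intervalIntegral.integral_const_mul, intervalIntegral.integral_of_le hRl,
      intervalIntegral.integral_of_le hRl]
    refine setIntegral_congr_fun measurableSet_Ioc fun η hη => ?_
    simp only [hf]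
    rw [Real.log_mul hl.ne' hη.1.ne', ← exp_add, ← exp_add, ← exp_add]
    congr 1
    push_cast
    ring
  have unit : ‖∫ η in (0 : ℝ)..R / lam, cexp (s * (Real.log η : ℂ)) *
        cexp (I * ((x * lam * η + t * lam ^ 4 * η ^ 4 : ℝ) : ℂ))‖ ≤ 4 * ‖s‖ + 31 := by
    rcases abs_cases t with ⟨h, _⟩ | ⟨h, _⟩
    · rw [h] at hl4
      simpa only [hl4, one_mul] using norm_unit_kernel_le h0 h1 (x * lam) hRl
    · have : t * lam ^ 4 = -1 := by rw [h] at hl4; linarith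
      simpa only [this, neg_one_mul] using norm_unit_kernel_neg_le h0 h1 (x * lam) hRl
  rw [sub, pull, norm_mul, norm_mul, norm_cexp_mul_log hl, norm_real, Real.norm_eq_abs,
    abs_of_pos hl, ← mul_assoc, hlp, mul_comm]
  gcongr

/-- Uniform bound for the truncated kernel of `D^s e^{it∂_x⁴}`, `0 ≤ re s ≤ 1`. -/
theorem norm_kernel_le {s : ℂ} (h0 : 0 ≤ s.re) (h1 : s.re ≤ 1) (x : ℝ) {t R : ℝ}
    (ht : t ≠ 0) (hR : 0 ≤ R) :
    ‖∫ ξ in Set.Ioc (-R) R, cexp (s * (Real.log ξ : ℂ)) *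
        cexp (I * ((x * ξ + t * ξ ^ 4 : ℝ) : ℂ))‖ ≤
      2 * (4 * ‖s‖ + 31) * |t| ^ (-((1 + s.re) / 4)) := by
  set f : ℝ → ℝ → ℂ := fun x ξ => cexp (s * (Real.log ξ : ℂ)) *
        cexp (I * ((x * ξ + t * ξ ^ 4 : ℝ) : ℂ)) with hf
  have hfm : Measurable (f x) := by fun_prop
  have hfint : IntervalIntegrable (f x) volume (-R) R := by
    rw [intervalIntegrable_iff_integrableOn_Ioc_of_le (by linarith)]
    refine Measure.integrableOn_of_bounded (M := max 1 (R ^ s.re)) (by simp)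
      hfm.aestronglyMeasurable ?_
    refine (ae_restrict_iff' measurableSet_Ioc).2 (ae_of_all _ fun ξ hξ => ?_)
    rw [hf, norm_mul, mul_comm I, norm_exp_ofReal_mul_I, mul_one]
    rcases eq_or_ne ξ 0 with rfl | hne
    · simp
    · rw [← Real.log_abs, norm_cexp_mul_log (abs_pos.2 hne)]
      exact le_max_of_le_right (Real.rpow_le_rpow (abs_nonneg _) (abs_le.2 ⟨hξ.1.le, hξ.2⟩) h0)
  have hneg : ∫ ξ in (-R)..0, f x ξ = ∫ ξ in (0 : ℝ)..R, f (-x) ξ := by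
    rw [← neg_zero, ← intervalIntegral.integral_comp_neg]
    simp [hf, Real.log_neg_eq_log, Even.neg_pow (by decide : Even 4)]
  have hR' : -R ≤ R := by linarith
  have h₁ : IntervalIntegrable (f x) volume (-R) 0 :=
    hfint.mono_set (Set.uIcc_subset_uIcc_left (Set.mem_uIcc.2 (Or.inl ⟨by linarith, hR⟩)))
  have h₂ : IntervalIntegrable (f x) volume 0 R :=
    hfint.mono_set (Set.uIcc_subset_uIcc_right (Set.mem_uIcc.2 (Or.inl ⟨by linarith, hR⟩)))
  rw [← intervalIntegral.integral_of_le hR',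
    ← intervalIntegral.integral_add_adjacent_intervals h₁ h₂, hneg]
  refine (norm_add_le _ _).trans ?_
  have e1 := norm_half_kernel_le h0 h1 x ht hR
  have e2 := norm_half_kernel_le h0 h1 (-x) ht hR
  linarith

theorem norm_mul_cexp_le {Ω : Type*} (c : Ω → ℂ) (L : Ω → ℝ) {z : ℂ} (h0 : 0 ≤ z.re)
    (h1 : z.re ≤ 1) (w : Ω) : ‖c w * cexp (z * L w)‖ ≤ ‖c w‖ + ‖c w‖ * Real.exp (L w) := by
  rw [norm_mul, norm_exp, re_mul_ofReal, ← mul_one_add]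
  gcongr
  rcases le_total 0 (L w) with h | h
  · have : Real.exp (z.re * L w) ≤ Real.exp (L w) := Real.exp_le_exp.2 (by nlinarith)
    linarith
  · have : Real.exp (z.re * L w) ≤ 1 := Real.exp_le_one_iff.2 (by nlinarith)
    linarith [Real.exp_pos (L w)]

section Laplace

open Complex.HadamardThreeLines

variable {Ω : Type*} [MeasurableSpace Ω] {μ : Measure Ω} {c : Ω → ℂ} {L : Ω → ℝ}

theorem aestronglyMeasurable_mul_cexp (hc : AEStronglyMeasurable c μ) (hL : AEMeasurable L μ)
    (z : ℂ) : AEStronglyMeasurable (fun w => c w * cexp (z * L w)) μ :=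
  hc.mul (by fun_prop : AEMeasurable (fun w => cexp (z * L w)) μ).aestronglyMeasurable

theorem abs_mul_exp_mul_le {δ x l : ℝ} (hδ : 0 < δ) (h0 : δ ≤ x) (h1 : x ≤ 1 - δ) :
    |l| * Real.exp (x * l) ≤ δ⁻¹ * (1 + Real.exp l) := by
  have h2 : δ * |l| ≤ Real.exp (δ * |l|) := by linarith [Real.add_one_le_exp (δ * |l|)]
  have h3 : |l| ≤ δ⁻¹ * Real.exp (δ * |l|) := by
    rw [inv_mul_eq_div, le_div_iff₀ hδ]; linarith
  calc _ ≤ δ⁻¹ * Real.exp (δ * |l|) * Real.exp (x * l) := by gcongr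
    _ = δ⁻¹ * Real.exp (δ * |l| + x * l) := by rw [Real.exp_add]; ring
    _ ≤ _ := by
      gcongr
      rcases abs_cases l with ⟨h, h'⟩ | ⟨h, h'⟩
      · have : Real.exp (δ * |l| + x * l) ≤ Real.exp l := Real.exp_le_exp.2 (by rw [h]; nlinarith)
        linarith
      · have : Real.exp (δ * |l| + x * l) ≤ 1 := Real.exp_le_one_iff.2 (by rw [h]; nlinarith)
        linarith [Real.exp_pos l]

theorem diffContOnCl_integral_mul_cexp (hc : Integrable c μ) (hL : AEMeasurable L μ)
    (hcL : Integrable (fun w => ‖c w‖ * Real.exp (L w)) μ) :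
    DiffContOnCl ℂ (fun z : ℂ => ∫ w, c w * cexp (z * L w) ∂μ) (verticalStrip 0 1) := by
  have hb : Integrable (fun w => ‖c w‖ + ‖c w‖ * Real.exp (L w)) μ := hc.norm.add hcL
  have hm := aestronglyMeasurable_mul_cexp hc.1 hL
  refine ⟨fun z₀ hz₀ => ?_, ?_⟩
  · have hz₀' : 0 < z₀.re ∧ z₀.re < 1 := hz₀
    set δ := min z₀.re (1 - z₀.re) / 2 with hδ
    have hδ0 : 0 < δ := by
      have : 0 < min z₀.re (1 - z₀.re) := lt_min hz₀'.1 (by linarith)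
      positivity
    have hre : ∀ z ∈ Metric.ball z₀ δ, δ ≤ z.re ∧ z.re ≤ 1 - δ := fun z hz => by
      have h1 : |(z - z₀).re| < δ := (abs_re_le_norm _).trans_lt (by simpa [dist_eq_norm] using hz)
      rw [sub_re, abs_lt] at h1
      have h2 := min_le_left z₀.re (1 - z₀.re)
      have h3 := min_le_right z₀.re (1 - z₀.re)
      constructor <;> linarith
    have := hasDerivAt_integral_of_dominated_loc_of_deriv_le (μ := μ) (x₀ := z₀)
      (F := fun z w => c w * cexp (z * L w)) (s := Metric.ball z₀ δ)
      (F' := fun z w => c w * (cexp (z * L w) * (L w : ℂ)))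
      (bound := fun w => δ⁻¹ * (‖c w‖ + ‖c w‖ * Real.exp (L w)))
      (Metric.ball_mem_nhds _ hδ0) (Filter.Eventually.of_forall hm)
      (hb.mono' (hm z₀) (ae_of_all _ fun w =>
        norm_mul_cexp_le c L hz₀'.1.le hz₀'.2.le w))
      (hc.1.mul (by fun_prop : AEMeasurable
        (fun w => cexp (z₀ * L w) * (L w : ℂ)) μ).aestronglyMeasurable)
      (ae_of_all _ fun w z hz => by
        obtain ⟨h1, h2⟩ := hre z hz
        rw [norm_mul, norm_mul, norm_exp, re_mul_ofReal, norm_real, Real.norm_eq_abs]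
        calc _ = ‖c w‖ * (|L w| * Real.exp (z.re * L w)) := by ring
          _ ≤ ‖c w‖ * (δ⁻¹ * (1 + Real.exp (L w))) :=
            mul_le_mul_of_nonneg_left (abs_mul_exp_mul_le hδ0 h1 h2) (norm_nonneg _)
          _ = _ := by ring)
      (hb.const_mul _)
      (ae_of_all _ fun w z _ => by
        simpa using ((hasDerivAt_mul_const (L w : ℂ)).cexp).const_mul (c w))
    exact this.2.differentiableAt.differentiableWithinAt
  · have hcl : closure (verticalStrip 0 1) = re ⁻¹' Set.Icc 0 1 := by
      rw [verticalStrip, closure_preimage_re, closure_Ioo zero_ne_one]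
    rw [hcl]
    refine continuousOn_of_dominated (bound := fun w => ‖c w‖ + ‖c w‖ * Real.exp (L w))
      (fun z _ => hm z) (fun z hz => ae_of_all _ fun w => norm_mul_cexp_le c L hz.1 hz.2 w) hb
      (ae_of_all _ fun w => by fun_prop)

/-- Three lines theorem for a family of Laplace type integrals, allowing linear growth on the line
`re z = 1`. -/
theorem norm_integral_mul_cexp_le_interp (hc : Integrable c μ) (hL : AEMeasurable L μ)
    (hcL : Integrable (fun w => ‖c w‖ * Real.exp (L w)) μ) {A B : ℝ} (hA : 0 ≤ A) (hB : 0 ≤ B)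
    (h0 : ∀ z : ℂ, z.re = 0 → ‖∫ w, c w * cexp (z * L w) ∂μ‖ ≤ A)
    (h1 : ∀ z : ℂ, z.re = 1 → ‖∫ w, c w * cexp (z * L w) ∂μ‖ ≤ B * (1 + |z.im|))
    {θ : ℝ} (hθ0 : 0 ≤ θ) (hθ1 : θ ≤ 1) :
    ‖∫ w, c w * cexp (θ * L w) ∂μ‖ ≤ 6 * (A ^ (1 - θ) * B ^ θ) := by
  set F : ℂ → ℂ := fun z => ∫ w, c w * cexp (z * L w) ∂μ with hF
  have hb : Integrable (fun w => ‖c w‖ + ‖c w‖ * Real.exp (L w)) μ := hc.norm.add hcL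
  have hsq : ∀ z : ℂ, (z ^ 2).re = z.re ^ 2 - z.im ^ 2 := fun z => by simp [sq]
  have hexp : ∀ y : ℝ, Real.exp (1 - y ^ 2) * (1 + |y|) ≤ 6 := fun y => by
    have e1 : 1 + |y| ≤ 2 * Real.exp (y ^ 2) := by
      have := Real.add_one_le_exp (y ^ 2)
      nlinarith [sq_nonneg (|y| - 1), sq_abs y]
    calc _ ≤ Real.exp (1 - y ^ 2) * (2 * Real.exp (y ^ 2)) := by gcongr
      _ = 2 * Real.exp 1 := by rw [mul_left_comm, ← Real.exp_add]; simp
      _ ≤ 6 := by linarith [Real.exp_one_lt_d9]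
  have key := norm_le_interp_of_mem_verticalClosedStrip₀₁' (fun z => cexp (z ^ 2) * F z)
    (z := (θ : ℂ)) (a := A) (b := 6 * B) (by simp [verticalClosedStrip, hθ0, hθ1])
    ((by fun_prop : Differentiable ℂ fun z : ℂ => cexp (z ^ 2)).diffContOnCl.smul
      (diffContOnCl_integral_mul_cexp hc hL hcL))
    (by
      refine ⟨Real.exp 1 * ∫ w, (‖c w‖ + ‖c w‖ * Real.exp (L w)) ∂μ, ?_⟩
      rintro _ ⟨z, hz, rfl⟩
      have hz' : 0 ≤ z.re ∧ z.re ≤ 1 := hz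
      simp only [Function.comp_apply, norm_mul, norm_exp, hsq]
      gcongr
      · nlinarith [sq_nonneg z.im]
      · exact norm_integral_le_of_norm_le hb
          (ae_of_all _ fun w => norm_mul_cexp_le c L hz'.1 hz'.2 w))
    (fun z hz => by
      have hz' : z.re = 0 := hz
      rw [norm_mul, norm_exp, hsq, hz']
      calc _ ≤ 1 * A := by
            gcongr
            · exact Real.exp_le_one_iff.2 (by nlinarith [sq_nonneg z.im])
            · exact h0 z hz'
        _ = A := one_mul A)
    (fun z hz => by
      have hz' : z.re = 1 := hz
      rw [norm_mul, norm_exp, hsq, hz', one_pow]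
      calc _ ≤ Real.exp (1 - z.im ^ 2) * (B * (1 + |z.im|)) := by
            gcongr; exact h1 z hz'
        _ = (Real.exp (1 - z.im ^ 2) * (1 + |z.im|)) * B := by ring
        _ ≤ 6 * B := by gcongr; exact hexp _)
  rw [ofReal_re, norm_mul, norm_exp, hsq, ofReal_re, ofReal_im] at key
  calc ‖F θ‖ ≤ Real.exp (θ ^ 2 - 0 ^ 2) * ‖F θ‖ :=
        le_mul_of_one_le_left (norm_nonneg _) (Real.one_le_exp (by simp [sq_nonneg]))
    _ ≤ A ^ (1 - θ) * (6 * B) ^ θ := key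
    _ = A ^ (1 - θ) * (6 ^ θ * B ^ θ) := by rw [Real.mul_rpow (by norm_num) hB]
    _ ≤ A ^ (1 - θ) * (6 * B ^ θ) := by
      gcongr
      simpa using Real.rpow_le_rpow_of_exponent_le (by norm_num : (1 : ℝ) ≤ 6) hθ1
    _ = _ := by ring

end Laplace

open scoped FourierTransform in
/-- Plancherel's theorem for the Fourier integral of `f ∈ L¹ ∩ L²`. -/
theorem fourier_ae_eq_coeFn_fourier_toLp {f : ℝ → ℂ} (hf : Integrable f) (hf2 : MemLp f 2) :
    𝓕 f =ᵐ[volume] (𝓕 (hf2.toLp f) : Lp (α := ℝ) ℂ 2) := by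
  refine ae_eq_of_integral_contDiff_smul_eq ?_ ?_ fun g hg hgc => ?_
  · exact (VectorFourier.fourierIntegral_continuous Real.continuous_fourierChar
      (by exact continuous_inner) hf).locallyIntegrable
  · exact ((Lp.memLp _).locallyIntegrable (by norm_num))
  · set φ : SchwartzMap ℝ ℂ := (hgc.comp_left (g := ((↑) : ℝ → ℂ)) ofReal_zero).toSchwartzMap
      (ofRealCLM.contDiff.comp hg) with hφ
    have hφg : ∀ x, φ x = (g x : ℂ) := fun x => rfl
    have h1 := congrArg (fun T => T φ) (Lp.fourier_toTemperedDistribution_eq (hf2.toLp f))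
    simp only [TemperedDistribution.fourier_apply, Lp.toTemperedDistribution_apply] at h1
    have h2 := VectorFourier.integral_fourierIntegral_smul_eq_flip (μ := volume) (ν := volume)
      (L := innerₗ ℝ) (f := f) (g := φ) Real.continuous_fourierChar continuous_inner hf φ.integrable
    have h3 : ∫ x, (𝓕 φ) x • (hf2.toLp f) x = ∫ x, f x • (𝓕 (φ : ℝ → ℂ)) x := by
      refine integral_congr_ae ?_
      filter_upwards [hf2.coeFn_toLp] with x hx
      rw [hx, SchwartzMap.fourier_coe, smul_eq_mul, smul_eq_mul, mul_comm]
    calc ∫ x, g x • 𝓕 f x = ∫ x, 𝓕 f x • φ x := by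
          simp only [hφg, smul_eq_mul, real_smul, mul_comm]
      _ = ∫ x, f x • (𝓕 (φ : ℝ → ℂ)) x := by
          rw [flip_innerₗ] at h2
          exact h2
      _ = _ := by
          rw [← h3, h1]
          simp only [hφg, smul_eq_mul, real_smul]

open scoped FourierTransform in
theorem eLpNorm_fourier_eq {f : ℝ → ℂ} (hf : Integrable f) (hf2 : MemLp f 2) :
    eLpNorm (𝓕 f) 2 volume = eLpNorm f 2 volume := by
  rw [eLpNorm_congr_ae (fourier_ae_eq_coeFn_fourier_toLp hf hf2)]
  have h := Lp.norm_fourier_eq (hf2.toLp f)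
  rw [Lp.norm_def, Lp.norm_def] at h
  rw [(ENNReal.toReal_eq_toReal_iff' (Lp.eLpNorm_ne_top _) (Lp.eLpNorm_ne_top _)).1 h,
    eLpNorm_congr_ae hf2.coeFn_toLp]

open scoped FourierTransform in
theorem fourierInt_eq_fourier (f : ℝ → ℂ) (ξ : ℝ) : fourierInt f ξ = 𝓕 f (ξ / (2 * Real.pi)) := by
  rw [Real.fourier_eq']
  refine integral_congr_ae (ae_of_all _ fun x => ?_)
  have : (Real.pi : ℂ) ≠ 0 := by exact_mod_cast Real.pi_ne_zero
  simp only [smul_eq_mul, RCLike.inner_apply, conj_trivial]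
  congr 2
  push_cast
  field_simp

theorem continuous_fourierInt {f : ℝ → ℂ} (hf : Integrable f) : Continuous (fourierInt f) := by
  rw [funext (fourierInt_eq_fourier f)]
  have : Continuous (FourierTransform.fourier f) :=
    VectorFourier.fourierIntegral_continuous Real.continuous_fourierChar
      (by exact continuous_inner) hf
  exact this.comp (by fun_prop)

/-- Plancherel's theorem in the normalization of `fourierInt`. -/
theorem integrable_norm_fourierInt_sq {f : ℝ → ℂ} (hf : Integrable f) (hf2 : MemLp f 2) :
    Integrable (fun ξ => ‖fourierInt f ξ‖ ^ 2) ∧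
      ∫ ξ, ‖fourierInt f ξ‖ ^ 2 = 2 * Real.pi * ∫ x, ‖f x‖ ^ 2 := by
  have hm : MemLp (FourierTransform.fourier f) 2 := by
    rw [memLp_congr_ae (fourier_ae_eq_coeFn_fourier_toLp hf hf2)]
    exact Lp.memLp _
  have h2 : (0 : ℝ) < 2 * Real.pi := by positivity
  simp only [fourierInt_eq_fourier f]
  refine ⟨(hm.integrable_norm_pow (by norm_num)).comp_div h2.ne', ?_⟩
  rw [Measure.integral_comp_div (fun η => ‖FourierTransform.fourier f η‖ ^ 2), smul_eq_mul,
    abs_of_pos h2]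
  congr 1
  have h := eLpNorm_fourier_eq hf hf2
  rw [hm.eLpNorm_eq_integral_rpow_norm (by norm_num) (by norm_num),
    hf2.eLpNorm_eq_integral_rpow_norm (by norm_num) (by norm_num)] at h
  norm_num at h
  have n1 : 0 ≤ ∫ ξ, ‖FourierTransform.fourier f ξ‖ ^ 2 := by positivity
  have n2 : 0 ≤ ∫ ξ, ‖f ξ‖ ^ 2 := by positivity
  rw [ENNReal.ofReal_eq_ofReal_iff (by positivity) (by positivity)] at h
  exact (Real.rpow_left_inj n1 n2 (by norm_num)).1 h

/-- Cauchy-Schwarz and Plancherel. -/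
theorem integral_norm_fourierInt_mul_le {f g : ℝ → ℂ} (hf : Integrable f) (hf2 : MemLp f 2)
    (hg : Integrable g) (hg2 : MemLp g 2) :
    Integrable (fun ξ => ‖fourierInt f ξ‖ * ‖fourierInt g (-ξ)‖) ∧
    ∫ ξ, ‖fourierInt f ξ‖ * ‖fourierInt g (-ξ)‖ ≤
      2 * Real.pi * ((∫ x, ‖f x‖ ^ 2) * ∫ x, ‖g x‖ ^ 2) ^ (1 / 2 : ℝ) := by
  obtain ⟨if2, ef⟩ := integrable_norm_fourierInt_sq hf hf2
  obtain ⟨ig2, eg⟩ := integrable_norm_fourierInt_sq hg hg2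
  have mf : MemLp (fun ξ => ‖fourierInt f ξ‖) 2 :=
    (memLp_two_iff_integrable_sq (continuous_fourierInt hf).norm.aestronglyMeasurable).2 if2
  have mg : MemLp (fun ξ => ‖fourierInt g (-ξ)‖) 2 :=
    (memLp_two_iff_integrable_sq
      ((continuous_fourierInt hg).comp continuous_neg).norm.aestronglyMeasurable).2 ig2.comp_neg
  refine ⟨mf.integrable_mul mg, ?_⟩
  have := integral_mul_le_Lp_mul_Lq_of_nonneg (μ := volume) Real.HolderConjugate.two_two
    (f := fun ξ => ‖fourierInt f ξ‖) (g := fun ξ => ‖fourierInt g (-ξ)‖)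
    (ae_of_all _ fun _ => norm_nonneg _) (ae_of_all _ fun _ => norm_nonneg _)
    (by simpa using mf) (by simpa using mg)
  refine this.trans_eq ?_
  have eg' : ∫ ξ, ‖fourierInt g (-ξ)‖ ^ 2 = 2 * Real.pi * ∫ x, ‖g x‖ ^ 2 := by
    rw [← eg]
    exact integral_neg_eq_self (fun ξ => ‖fourierInt g ξ‖ ^ 2) volume
  simp only [Real.rpow_two]
  have n1 : 0 ≤ ∫ x, ‖f x‖ ^ 2 := by positivity
  have n2 : 0 ≤ ∫ x, ‖g x‖ ^ 2 := by positivity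
  have h2 : (0 : ℝ) < 2 * Real.pi := by positivity
  rw [ef, eg', ← Real.mul_rpow (by positivity) (by positivity),
    show 2 * Real.pi * (∫ x, ‖f x‖ ^ 2) * (2 * Real.pi * ∫ x, ‖g x‖ ^ 2) =
      (2 * Real.pi) ^ 2 * ((∫ x, ‖f x‖ ^ 2) * ∫ x, ‖g x‖ ^ 2) by ring,
    Real.mul_rpow (by positivity) (by positivity), ← Real.sqrt_eq_rpow, Real.sqrt_sq h2.le]

/-- The integrand of the bilinear form `⟨k(D) f, g⟩`, as a function of `(ξ, y, x)`. -/
noncomputable def multiplierIntegrand (k f g : ℝ → ℂ) (w : ℝ × ℝ × ℝ) : ℂ :=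
  k w.1 * ((cexp (-(I * w.2.1 * w.1)) * f w.2.1) *
    (cexp (-(I * w.2.2 * ((-w.1 : ℝ) : ℂ))) * g w.2.2))

section

variable {k f g : ℝ → ℂ} {S : Set ℝ}

theorem integrable_multiplierIntegrand (hk : IntegrableOn k S) (hf : Integrable f)
    (hg : Integrable g) : Integrable (multiplierIntegrand k f g)
      ((volume.restrict S).prod (volume.prod volume)) := by
  have h := (Integrable.mul_prod hk (hf.mul_prod hg))
  refine (h.bdd_mul (f := fun w : ℝ × ℝ × ℝ => cexp (-(I * w.2.1 * w.1)) *
    cexp (-(I * w.2.2 * ((-w.1 : ℝ) : ℂ)))) (c := 1) ?_ ?_).congr ?_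
  · exact (by fun_prop : Continuous _).aestronglyMeasurable
  · refine ae_of_all _ fun w => ?_
    simp [norm_exp]
  · refine ae_of_all _ fun w => ?_
    simp only [multiplierIntegrand]
    ring

theorem integral_multiplierIntegrand (hk : IntegrableOn k S) (hf : Integrable f)
    (hg : Integrable g) :
    ∫ w, multiplierIntegrand k f g w ∂((volume.restrict S).prod (volume.prod volume)) =
      ∫ ξ in S, k ξ * (fourierInt f ξ * fourierInt g (-ξ)) := by
  rw [integral_prod _ (integrable_multiplierIntegrand hk hf hg)]
  refine integral_congr_ae (ae_of_all _ fun ξ => ?_)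
  simp only [multiplierIntegrand]
  rw [integral_const_mul, integral_prod_mul (fun y : ℝ => cexp (-(I * y * ξ)) * f y)
    (fun x : ℝ => cexp (-(I * x * ((-ξ : ℝ) : ℂ))) * g x)]
  rfl

theorem integral_multiplierIntegrand_symm (hk : IntegrableOn k S) (hf : Integrable f)
    (hg : Integrable g) :
    ∫ w, multiplierIntegrand k f g w ∂((volume.restrict S).prod (volume.prod volume)) =
      ∫ p : ℝ × ℝ, f p.1 * g p.2 * ∫ ξ in S, k ξ * cexp (I * (((p.2 - p.1) * ξ : ℝ) : ℂ)) := by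
  rw [integral_prod_symm _ (integrable_multiplierIntegrand hk hf hg), ← Measure.volume_eq_prod]
  refine integral_congr_ae (ae_of_all _ fun p => ?_)
  simp only [multiplierIntegrand]
  rw [← integral_const_mul]
  refine integral_congr_ae (ae_of_all _ fun ξ => ?_)
  have : cexp (I * (((p.2 - p.1) * ξ : ℝ) : ℂ)) =
      cexp (-(I * p.1 * ξ)) * cexp (-(I * p.2 * ((-ξ : ℝ) : ℂ))) := by
    rw [← Complex.exp_add]
    congr 1
    push_cast
    ring
  simp only [this]
  ring

end

/-- `a` and `ℓ` are the data of an analytic family `z ↦ a * exp (z * ℓ)` lying in the ball of radius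
`√U` of `L²` for `re z = 0`, and in the ball of radius `U` of `L¹` for `re z = 1`. -/
structure IsSteinFamily (a : ℝ → ℂ) (ℓ : ℝ → ℝ) (U : ℝ) : Prop where
  integrable : Integrable a
  memLp_two : MemLp a 2
  measurable_exponent : Measurable ℓ
  integrable_mul_exp : Integrable (fun y => ‖a y‖ * Real.exp (ℓ y))
  integral_sq : ∫ y, ‖a y‖ ^ 2 = U
  integral_mul_exp : ∫ y, ‖a y‖ * Real.exp (ℓ y) = U

namespace IsSteinFamily

variable {a : ℝ → ℂ} {ℓ : ℝ → ℝ} {U : ℝ} {z : ℂ}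

theorem nonneg (h : IsSteinFamily a ℓ U) : 0 ≤ U := by
  rw [← h.integral_sq]; positivity

theorem integrable_mul_cexp (h : IsSteinFamily a ℓ U) (h0 : 0 ≤ z.re) (h1 : z.re ≤ 1) :
    Integrable (fun y => a y * cexp (z * ℓ y)) :=
  (h.integrable.norm.add h.integrable_mul_exp).mono'
    (aestronglyMeasurable_mul_cexp h.integrable.1 h.measurable_exponent.aemeasurable z)
    (ae_of_all _ (norm_mul_cexp_le a ℓ h0 h1))

theorem norm_mul_cexp_of_re_eq_zero (a : ℝ → ℂ) (ℓ : ℝ → ℝ) (hz : z.re = 0) (y : ℝ) :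
    ‖a y * cexp (z * ℓ y)‖ = ‖a y‖ := by
  simp [norm_exp, hz]

theorem memLp_mul_cexp (h : IsSteinFamily a ℓ U) (hz : z.re = 0) :
    MemLp (fun y => a y * cexp (z * ℓ y)) 2 :=
  h.memLp_two.of_le
    (aestronglyMeasurable_mul_cexp h.integrable.1 h.measurable_exponent.aemeasurable z)
    (ae_of_all _ fun y => (norm_mul_cexp_of_re_eq_zero a ℓ hz y).le)

theorem integral_norm_mul_cexp (h : IsSteinFamily a ℓ U) (hz : z.re = 1) :
    ∫ y, ‖a y * cexp (z * ℓ y)‖ = U := by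
  rw [← h.integral_mul_exp]
  simp [norm_exp, hz]

end IsSteinFamily

/-- The analytic family of multipliers `|ξ|^{αz} e^{itξ⁴}`. -/
noncomputable def quarticMultiplier (α t : ℝ) (z : ℂ) (ξ : ℝ) : ℂ :=
  cexp (α * z * (Real.log ξ : ℂ)) * cexp (I * ((t * ξ ^ 4 : ℝ) : ℂ))

theorem norm_quarticMultiplier (α t : ℝ) (z : ℂ) (ξ : ℝ) :
    ‖quarticMultiplier α t z ξ‖ = Real.exp (z.re * (α * Real.log ξ)) := by
  rw [quarticMultiplier, norm_mul, norm_exp, norm_exp]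
  simp only [re_mul_ofReal, re_ofReal_mul, I_re, zero_mul, Real.exp_zero, mul_one]
  congr 1
  ring

theorem exp_mul_log_le {α R ξ : ℝ} (hα : α ∈ Set.Icc (0 : ℝ) 1) (hξ : ξ ∈ Set.Ioc (-R) R) :
    Real.exp (α * Real.log ξ) ≤ 1 + R := by
  have hx : |ξ| ≤ R := abs_le.2 ⟨hξ.1.le, hξ.2⟩
  rw [← Real.log_abs]
  rcases eq_or_ne ξ 0 with rfl | h
  · simpa using hx
  · have hp : 0 < |ξ| := abs_pos.2 h
    have : α * Real.log |ξ| ≤ Real.log (1 + R) := by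
      rcases le_total 0 (Real.log |ξ|) with h | h
      · have := Real.log_le_log hp (hx.trans (by linarith : R ≤ 1 + R))
        nlinarith [hα.2]
      · have := Real.log_nonneg (by linarith : 1 ≤ 1 + R)
        nlinarith [hα.1]
    exact (Real.exp_le_exp.2 this).trans_eq (Real.exp_log (by linarith))

theorem measurable_quarticMultiplier (α t : ℝ) (z : ℂ) : Measurable (quarticMultiplier α t z) := by
  unfold quarticMultiplier; fun_prop

theorem integrableOn_quarticMultiplier {α t R : ℝ} {z : ℂ} (hα : α ∈ Set.Icc (0 : ℝ) 1)
    (h0 : 0 ≤ z.re) (h1 : z.re ≤ 1) : IntegrableOn (quarticMultiplier α t z) (Set.Ioc (-R) R) := by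
  refine Measure.integrableOn_of_bounded (M := 1 + R) (by simp)
    (measurable_quarticMultiplier α t z).aestronglyMeasurable ?_
  refine (ae_restrict_mem measurableSet_Ioc).mono fun ξ hξ => ?_
  rw [norm_quarticMultiplier, ← mul_assoc, mul_comm z.re]
  exact exp_mul_log_le ⟨mul_nonneg hα.1 h0, mul_le_one₀ hα.2 h0 h1⟩ hξ

section

variable {α t R : ℝ} {a b : ℝ → ℂ} {ℓ m : ℝ → ℝ} {U G : ℝ}

theorem norm_integral_stein_le_of_re_eq_zero
    (ha : IsSteinFamily a ℓ U) (hb : IsSteinFamily b m G) {z : ℂ} (hz : z.re = 0) :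
    ‖∫ ξ in Set.Ioc (-R) R, quarticMultiplier α t z ξ *
        (fourierInt (fun y => a y * cexp (z * ℓ y)) ξ *
          fourierInt (fun x => b x * cexp (z * m x)) (-ξ))‖ ≤
      2 * Real.pi * (U * G) ^ (1 / 2 : ℝ) := by
  obtain ⟨hi, hle⟩ := integral_norm_fourierInt_mul_le
    (ha.integrable_mul_cexp (z := z) hz.ge (by linarith)) (ha.memLp_mul_cexp hz)
    (hb.integrable_mul_cexp (z := z) hz.ge (by linarith)) (hb.memLp_mul_cexp hz)
  simp only [IsSteinFamily.norm_mul_cexp_of_re_eq_zero _ _ hz, ha.integral_sq, hb.integral_sq]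
    at hle
  refine (norm_integral_le_integral_norm _).trans (le_trans ?_ hle)
  simp only [norm_mul, norm_quarticMultiplier, hz, zero_mul, Real.exp_zero, one_mul]
  exact setIntegral_le_integral hi (ae_of_all _ fun _ => by positivity)

theorem norm_integral_stein_le_of_re_eq_one (hα : α ∈ Set.Icc (0 : ℝ) 1) (ht : t ≠ 0) (hR : 0 ≤ R)
    (ha : IsSteinFamily a ℓ U) (hb : IsSteinFamily b m G) {z : ℂ} (hz : z.re = 1) :
    ‖∫ p : ℝ × ℝ, a p.1 * cexp (z * ℓ p.1) * (b p.2 * cexp (z * m p.2)) *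
        ∫ ξ in Set.Ioc (-R) R, quarticMultiplier α t z ξ *
          cexp (I * (((p.2 - p.1) * ξ : ℝ) : ℂ))‖ ≤
      70 * |t| ^ (-((1 + α) / 4)) * (U * G) * (1 + |z.im|) := by
  have ia := ha.integrable_mul_cexp (z := z) (by linarith) hz.le
  have ib := hb.integrable_mul_cexp (z := z) (by linarith) hz.le
  have hK : ∀ x : ℝ, ‖∫ ξ in Set.Ioc (-R) R, quarticMultiplier α t z ξ *
      cexp (I * ((x * ξ : ℝ) : ℂ))‖ ≤ 70 * |t| ^ (-((1 + α) / 4)) * (1 + |z.im|) := fun x => by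
    have hre : (α * z).re = α := by rw [re_ofReal_mul, hz, mul_one]
    have h := norm_kernel_le (s := α * z) (by rw [hre]; exact hα.1) (by rw [hre]; exact hα.2) x
      ht hR
    rw [hre] at h
    have hs : ‖(α * z : ℂ)‖ ≤ 1 + |z.im| := by
      rw [norm_mul, norm_real, Real.norm_of_nonneg hα.1]
      have h1 := Complex.norm_le_abs_re_add_abs_im z
      rw [hz, abs_one] at h1
      nlinarith [norm_nonneg z, hα.2]
    calc _ = ‖∫ ξ in Set.Ioc (-R) R, cexp (α * z * (Real.log ξ : ℂ)) *
          cexp (I * ((x * ξ + t * ξ ^ 4 : ℝ) : ℂ))‖ := by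
          congr 2
          ext ξ
          rw [quarticMultiplier, mul_assoc, ← Complex.exp_add, ← mul_add]
          push_cast
          ring_nf
      _ ≤ _ := h
      _ ≤ 70 * (1 + |z.im|) * |t| ^ (-((1 + α) / 4)) := by
          refine mul_le_mul_of_nonneg_right ?_ (by positivity)
          linarith [abs_nonneg z.im]
      _ = _ := by ring
  calc _ ≤ ∫ p : ℝ × ℝ, ‖a p.1 * cexp (z * ℓ p.1)‖ * ‖b p.2 * cexp (z * m p.2)‖ *
        (70 * |t| ^ (-((1 + α) / 4)) * (1 + |z.im|)) := by
        refine norm_integral_le_of_norm_le ((ia.norm.mul_prod ib.norm).mul_const _)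
          (ae_of_all _ fun p => ?_)
        rw [norm_mul, norm_mul (a p.1 * _)]
        gcongr
        exact hK _
    _ = _ := by
        rw [integral_mul_const, Measure.volume_eq_prod,
          integral_prod_mul (fun y : ℝ => ‖a y * cexp (z * ℓ y)‖)
          (fun x : ℝ => ‖b x * cexp (z * m x)‖), ha.integral_norm_mul_cexp hz,
          hb.integral_norm_mul_cexp hz]
        ring

/-- Stein interpolation for the truncated propagator, in bilinear form. -/
theorem norm_integral_stein_le (hα : α ∈ Set.Icc (0 : ℝ) 1) (ht : t ≠ 0) (hR : 0 ≤ R)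
    (ha : IsSteinFamily a ℓ U) (hb : IsSteinFamily b m G) {θ : ℝ} (hθ0 : 0 ≤ θ) (hθ1 : θ ≤ 1) :
    ‖∫ ξ in Set.Ioc (-R) R, quarticMultiplier α t θ ξ *
        (fourierInt (fun y => a y * cexp (θ * ℓ y)) ξ *
          fourierInt (fun x => b x * cexp (θ * m x)) (-ξ))‖ ≤
      6 * ((2 * Real.pi * (U * G) ^ (1 / 2 : ℝ)) ^ (1 - θ) *
        (70 * |t| ^ (-((1 + α) / 4)) * (U * G)) ^ θ) := by
  set μ := (volume.restrict (Set.Ioc (-R) R)).prod ((volume : Measure ℝ).prod (volume : Measure ℝ))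
    with hμ
  set L : ℝ × ℝ × ℝ → ℝ := fun w => α * Real.log w.1 + (ℓ w.2.1 + m w.2.2) with hLdef
  have hL : AEMeasurable L μ := by
    have := ha.measurable_exponent
    have := hb.measurable_exponent
    exact (by fun_prop : Measurable L).aemeasurable
  have hrw : ∀ z : ℂ, (fun w => multiplierIntegrand (quarticMultiplier α t 0) a b w *
      cexp (z * L w)) = multiplierIntegrand (quarticMultiplier α t z)
        (fun y => a y * cexp (z * ℓ y)) (fun x => b x * cexp (z * m x)) := fun z => by
    ext w
    simp only [multiplierIntegrand, quarticMultiplier, hLdef, ofReal_add, mul_add, ofReal_mul,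
      Complex.exp_add, mul_zero, zero_mul, Complex.exp_zero, one_mul]
    rw [show (α : ℂ) * z * Real.log w.1 = z * (α * Real.log w.1) by ring]
    ring
  have hfint : ∀ z : ℂ, 0 ≤ z.re → z.re ≤ 1 → Integrable (fun w =>
      multiplierIntegrand (quarticMultiplier α t 0) a b w * cexp (z * L w)) μ := fun z h0 h1 => by
    rw [hrw]
    exact integrable_multiplierIntegrand (integrableOn_quarticMultiplier hα h0 h1)
      (ha.integrable_mul_cexp h0 h1) (hb.integrable_mul_cexp h0 h1)
  have hc : Integrable (multiplierIntegrand (quarticMultiplier α t 0) a b) μ := by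
    simpa using hfint 0 (by simp) (by simp)
  have hcL : Integrable (fun w => ‖multiplierIntegrand (quarticMultiplier α t 0) a b w‖ *
      Real.exp (L w)) μ := by
    simpa [norm_exp] using (hfint 1 (by simp) (by simp)).norm
  have hUG := mul_nonneg ha.nonneg hb.nonneg
  have key := norm_integral_mul_cexp_le_interp hc hL hcL
    (A := 2 * Real.pi * (U * G) ^ (1 / 2 : ℝ)) (B := 70 * |t| ^ (-((1 + α) / 4)) * (U * G))
    (by positivity) (by positivity) (fun z hz => ?_) (fun z hz => ?_) hθ0 hθ1
  · have e0 : 0 ≤ ((θ : ℂ)).re := by simpa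
    have e1 : ((θ : ℂ)).re ≤ 1 := by simpa
    rw [hrw, integral_multiplierIntegrand (integrableOn_quarticMultiplier hα e0 e1)
      (ha.integrable_mul_cexp e0 e1) (hb.integrable_mul_cexp e0 e1)] at key
    exact key
  · have e1 : z.re ≤ 1 := by linarith
    rw [hrw, integral_multiplierIntegrand (integrableOn_quarticMultiplier hα hz.ge e1)
      (ha.integrable_mul_cexp hz.ge e1) (hb.integrable_mul_cexp hz.ge e1)]
    exact norm_integral_stein_le_of_re_eq_zero ha hb hz
  · have e0 : 0 ≤ z.re := by linarith
    rw [hrw, integral_multiplierIntegrand_symm (integrableOn_quarticMultiplier hα e0 hz.le)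
      (ha.integrable_mul_cexp e0 hz.le) (hb.integrable_mul_cexp e0 hz.le)]
    exact norm_integral_stein_le_of_re_eq_one hα ht hR ha hb hz

end

/-- Polar decomposition: the amplitude at `z = 0` of the standard analytic family through `f`. -/
noncomputable def steinAmplitude (p : ℝ) (f : ℝ → ℂ) (y : ℝ) : ℂ :=
  f y / ‖f y‖ * ((‖f y‖ ^ (p / 2) : ℝ) : ℂ)

/-- The exponent of the standard analytic family through `f`. -/
noncomputable def steinExponent (p : ℝ) (f : ℝ → ℂ) (y : ℝ) : ℝ :=
  p / 2 * Real.log ‖f y‖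

section

variable {p : ℝ} {f : ℝ → ℂ}

theorem norm_steinAmplitude (hp : 0 < p) (y : ℝ) : ‖steinAmplitude p f y‖ = ‖f y‖ ^ (p / 2) := by
  rw [steinAmplitude, norm_mul, norm_div, norm_real, norm_real, norm_norm,
    Real.norm_of_nonneg (by positivity)]
  rcases eq_or_ne (f y) 0 with h | h
  · simp [h, Real.zero_rpow (by positivity : p / 2 ≠ 0)]
  · rw [div_self (norm_ne_zero_iff.2 h), one_mul]

theorem norm_steinAmplitude_sq (hp : 0 < p) (y : ℝ) :
    ‖steinAmplitude p f y‖ ^ 2 = ‖f y‖ ^ p := by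
  rw [norm_steinAmplitude hp, ← Real.rpow_natCast, ← Real.rpow_mul (norm_nonneg _)]
  congr 1
  push_cast
  ring

theorem norm_steinAmplitude_mul_exp (hp : 0 < p) (y : ℝ) :
    ‖steinAmplitude p f y‖ * Real.exp (steinExponent p f y) = ‖f y‖ ^ p := by
  rw [← norm_steinAmplitude_sq hp, sq, norm_steinAmplitude hp]
  rcases eq_or_ne (f y) 0 with h | h
  · simp [h, Real.zero_rpow (by positivity : p / 2 ≠ 0)]
  · rw [steinExponent, mul_comm (p / 2), ← Real.rpow_def_of_pos (norm_pos_iff.2 h)]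

theorem steinAmplitude_mul_cexp {θ : ℝ} (hθ : p / 2 * (1 + θ) = 1) (y : ℝ) :
    steinAmplitude p f y * cexp (θ * steinExponent p f y) = f y := by
  rcases eq_or_ne (f y) 0 with h | h
  · simp [steinAmplitude, h]
  · have hn := norm_pos_iff.2 h
    have : ‖f y‖ ^ (p / 2) * Real.exp (θ * steinExponent p f y) = ‖f y‖ := by
      rw [steinExponent, Real.rpow_def_of_pos hn, ← Real.exp_add,
        show Real.log ‖f y‖ * (p / 2) + θ * (p / 2 * Real.log ‖f y‖) =
          p / 2 * (1 + θ) * Real.log ‖f y‖ by ring, hθ, one_mul, Real.exp_log hn]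
    rw [steinAmplitude, mul_assoc, ← ofReal_mul, ← ofReal_exp, ← ofReal_mul, this,
      div_mul_cancel₀ _ (by exact_mod_cast hn.ne')]

theorem isSteinFamily_stein (hp : 0 < p) (hf : Measurable f)
    (h1 : Integrable (fun y => ‖f y‖ ^ (p / 2))) (h2 : Integrable (fun y => ‖f y‖ ^ p)) :
    IsSteinFamily (steinAmplitude p f) (steinExponent p f) (∫ y, ‖f y‖ ^ p) := by
  have hm : Measurable (steinAmplitude p f) := by
    unfold steinAmplitude; fun_prop
  refine ⟨?_, ?_, ?_, ?_, ?_, ?_⟩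
  · rw [← integrable_norm_iff hm.aestronglyMeasurable]
    simpa only [norm_steinAmplitude hp] using h1
  · rw [memLp_two_iff_integrable_sq_norm hm.aestronglyMeasurable]
    simpa only [norm_steinAmplitude_sq hp] using h2
  · unfold steinExponent; fun_prop
  · simpa only [norm_steinAmplitude_mul_exp hp] using h2
  · simp only [norm_steinAmplitude_sq hp]
  · simp only [norm_steinAmplitude_mul_exp hp]

end

theorem interpolation_constant_le {τ V θ : ℝ} (hτ : 0 ≤ τ) (hV : 0 ≤ V) (h0 : 0 ≤ θ)
    (h1 : θ ≤ 1) :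
    6 * ((2 * Real.pi * V ^ (1 / 2 : ℝ)) ^ (1 - θ) * (70 * τ * V) ^ θ) ≤
      420 * τ ^ θ * V ^ ((1 + θ) / 2) := by
  rcases hV.eq_or_lt with rfl | hV'
  · have : (0 : ℝ) ^ (1 - θ) * 0 ^ θ = 0 := by
      rcases h0.eq_or_lt with rfl | h
      · norm_num
      · simp [Real.zero_rpow h.ne']
    rw [Real.zero_rpow (by norm_num), mul_zero, mul_zero, this, mul_zero]
    positivity
  have hpi : 2 * Real.pi ≤ 70 := by linarith [Real.pi_le_four]
  calc _ ≤ 6 * ((70 * V ^ (1 / 2 : ℝ)) ^ (1 - θ) * (70 * τ * V) ^ θ) := by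
        have : 0 ≤ 1 - θ := by linarith
        gcongr
    _ = 6 * ((70 : ℝ) ^ (1 - θ) * 70 ^ θ) * τ ^ θ * ((V ^ (1 / 2 : ℝ)) ^ (1 - θ) * V ^ θ) := by
        rw [Real.mul_rpow (by positivity) (by positivity),
          Real.mul_rpow (by positivity) (by positivity), Real.mul_rpow (by positivity) hτ]
        ring
    _ = _ := by
        rw [← Real.rpow_add (by norm_num), ← Real.rpow_mul hV, ← Real.rpow_add hV']
        norm_num
        left
        congr 1
        ring

section

variable {f g : ℝ → ℂ} {p α t R θ : ℝ}

/-- The bilinear `L^p` estimate for the truncated propagator. -/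
theorem norm_integral_quarticMultiplier_le (hα : α ∈ Set.Icc (0 : ℝ) 1) (ht : t ≠ 0) (hR : 0 ≤ R)
    (hp : 0 < p) (hθ0 : 0 ≤ θ) (hθ1 : θ ≤ 1) (hθ : p / 2 * (1 + θ) = 1)
    (hf : Measurable f) (hf1 : Integrable (fun y => ‖f y‖ ^ (p / 2)))
    (hf2 : Integrable (fun y => ‖f y‖ ^ p)) (hg : Measurable g)
    (hg1 : Integrable (fun y => ‖g y‖ ^ (p / 2))) (hg2 : Integrable (fun y => ‖g y‖ ^ p)) :
    ‖∫ ξ in Set.Ioc (-R) R, quarticMultiplier α t θ ξ * (fourierInt f ξ * fourierInt g (-ξ))‖ ≤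
      420 * |t| ^ (-((1 + α) / 4) * θ) * (∫ y, ‖f y‖ ^ p) ^ p⁻¹ * (∫ y, ‖g y‖ ^ p) ^ p⁻¹ := by
  have h := norm_integral_stein_le hα ht hR (isSteinFamily_stein hp hf hf1 hf2)
    (isSteinFamily_stein hp hg hg1 hg2) hθ0 hθ1
  simp only [steinAmplitude_mul_cexp hθ] at h
  refine h.trans ((interpolation_constant_le (by positivity) (by positivity) hθ0 hθ1).trans_eq ?_)
  have hpe : (1 + θ) / 2 = p⁻¹ := by
    field_simp
    linarith
  rw [hpe, Real.mul_rpow (by positivity) (by positivity), ← Real.rpow_mul (abs_nonneg t)]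
  ring

/-- The propagator truncated to frequencies in `(-R, R]`. -/
noncomputable def truncatedPropagator (α t θ R : ℝ) (f : ℝ → ℂ) (x : ℝ) : ℂ :=
  ∫ ξ in Set.Ioc (-R) R, quarticMultiplier α t θ ξ * fourierInt f ξ * cexp (I * ((x * ξ : ℝ) : ℂ))

theorem norm_fourierInt_le (f : ℝ → ℂ) (ξ : ℝ) : ‖fourierInt f ξ‖ ≤ ∫ x, ‖f x‖ := by
  refine (norm_integral_le_integral_norm _).trans_eq ?_
  simp [norm_exp]

theorem integrableOn_quarticMultiplier_mul_fourierInt (hα : α ∈ Set.Icc (0 : ℝ) 1) (hθ0 : 0 ≤ θ)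
    (hθ1 : θ ≤ 1) (hf : Integrable f) :
    IntegrableOn (fun ξ => quarticMultiplier α t θ ξ * fourierInt f ξ) (Set.Ioc (-R) R) :=
  (integrableOn_quarticMultiplier hα (by simpa) (by simpa)).mul_bdd
    (continuous_fourierInt hf).aestronglyMeasurable (ae_of_all _ (norm_fourierInt_le f))

theorem continuous_truncatedPropagator (hα : α ∈ Set.Icc (0 : ℝ) 1) (hθ0 : 0 ≤ θ)
    (hθ1 : θ ≤ 1) (hf : Integrable f) : Continuous (truncatedPropagator α t θ R f) := by
  have h := integrableOn_quarticMultiplier_mul_fourierInt (t := t) (R := R) hα hθ0 hθ1 hf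
  refine continuous_of_dominated (fun x => ?_) (fun x => ae_of_all _ fun ξ => ?_) h.norm
    (ae_of_all _ fun ξ => by fun_prop)
  · exact h.1.mul (by fun_prop : Continuous _).aestronglyMeasurable
  · rw [norm_mul _ (cexp _)]
    simp [norm_exp]

theorem norm_truncatedPropagator_le (x : ℝ) : ‖truncatedPropagator α t θ R f x‖ ≤
    ∫ ξ in Set.Ioc (-R) R, ‖quarticMultiplier α t θ ξ * fourierInt f ξ‖ := by
  refine (norm_integral_le_integral_norm _).trans_eq ?_
  simp [norm_exp]

theorem integral_mul_truncatedPropagator (hα : α ∈ Set.Icc (0 : ℝ) 1) (hθ0 : 0 ≤ θ)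
    (hθ1 : θ ≤ 1) (hf : Integrable f) (hg : Integrable g) :
    ∫ x, g x * truncatedPropagator α t θ R f x =
      ∫ ξ in Set.Ioc (-R) R, quarticMultiplier α t θ ξ * (fourierInt f ξ * fourierInt g (-ξ)) := by
  have h := integrableOn_quarticMultiplier_mul_fourierInt (t := t) (R := R) hα hθ0 hθ1 hf
  have hi : Integrable (Function.uncurry fun x ξ : ℝ => g x * (quarticMultiplier α t θ ξ *
      fourierInt f ξ * cexp (I * ((x * ξ : ℝ) : ℂ))))
      (volume.prod (volume.restrict (Set.Ioc (-R) R))) := by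
    refine ((hg.mul_prod h).mul_bdd (g := fun p : ℝ × ℝ => cexp (I * ((p.1 * p.2 : ℝ) : ℂ)))
      (c := 1) (by fun_prop : Continuous _).aestronglyMeasurable ?_).congr ?_
    · exact ae_of_all _ fun p => by simp [norm_exp]
    · exact ae_of_all _ fun p => by simp only [Function.uncurry]; ring
  simp only [truncatedPropagator, ← integral_const_mul]
  rw [integral_integral_swap hi]
  refine integral_congr_ae (ae_of_all _ fun ξ => ?_)
  simp only [← mul_assoc]
  rw [show fourierInt g (-ξ) = ∫ x : ℝ, cexp (-(I * x * ((-ξ : ℝ) : ℂ))) * g x from rfl,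
    ← integral_const_mul]
  refine integral_congr_ae (ae_of_all _ fun x => ?_)
  simp only
  rw [show -(I * x * ((-ξ : ℝ) : ℂ)) = I * ((x * ξ : ℝ) : ℂ) by push_cast; ring]
  ring

end

/-- Converse Hölder inequality on a set of finite measure. -/
theorem eLpNorm_indicator_le_of_forall_bilinear {T : ℝ → ℂ} (hT : Measurable T) {M K r p : ℝ}
    (hM : ∀ x, ‖T x‖ ≤ M) (hK : 0 ≤ K) (hr : 2 ≤ r) (hp : r⁻¹ + p⁻¹ = 1) {E : Set ℝ}
    (hE : MeasurableSet E) (hE' : volume E ≠ ∞)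
    (h : ∀ g : ℝ → ℂ, Measurable g → (∃ N, ∀ x, ‖g x‖ ≤ N) → (∀ x ∉ E, g x = 0) →
      ‖∫ x, g x * T x‖ ≤ K * (∫ x, ‖g x‖ ^ p) ^ p⁻¹) :
    eLpNorm (E.indicator T) (ENNReal.ofReal r) volume ≤ ENNReal.ofReal K := by
  have hr0 : 0 < r := by linarith
  have hM0 : 0 ≤ M := (norm_nonneg _).trans (hM 0)
  have hri : r⁻¹ ≤ 2⁻¹ := inv_anti₀ (by norm_num) hr
  have hp0 : 0 < p := inv_pos.1 (by linarith)
  have hpr : (r - 1) * p = r := by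
    field_simp at hp
    linarith
  set g : ℝ → ℂ := E.indicator fun x => starRingEnd ℂ (T x) * ((‖T x‖ ^ (r - 2) : ℝ) : ℂ) with hg
  have hgm : Measurable g := by
    refine Measurable.indicator ?_ hE
    have : Measurable fun x => starRingEnd ℂ (T x) := continuous_conj.measurable.comp hT
    fun_prop
  have hgn : ∀ x ∈ E, ‖g x‖ = ‖T x‖ ^ (r - 1) := fun x hx => by
    rw [hg, Set.indicator_of_mem hx, norm_mul, RCLike.norm_conj, norm_real,
      Real.norm_of_nonneg (by positivity)]
    rcases eq_or_ne (T x) 0 with h0 | h0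
    · simp [h0, Real.zero_rpow (by linarith : r - 1 ≠ 0)]
    · rw [show r - 1 = 1 + (r - 2) by ring, Real.rpow_add (norm_pos_iff.2 h0), Real.rpow_one]
  have hg0 : ∀ x ∉ E, g x = 0 := fun x hx => Set.indicator_of_notMem hx _
  have hgp : ∀ x, ‖g x‖ ^ p = ‖E.indicator T x‖ ^ r := fun x => by
    by_cases hx : x ∈ E
    · rw [hgn x hx, ← Real.rpow_mul (norm_nonneg _), hpr, Set.indicator_of_mem hx]
    · simp [hg0 x hx, hx, Real.zero_rpow hp0.ne', Real.zero_rpow hr0.ne']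
  have hgT : ∀ x, g x * T x = ((‖E.indicator T x‖ ^ r : ℝ) : ℂ) := fun x => by
    by_cases hx : x ∈ E
    · rw [hg, Set.indicator_of_mem hx, Set.indicator_of_mem hx, mul_right_comm, conj_mul']
      rcases eq_or_ne (T x) 0 with h0 | h0
      · simp [h0, Real.zero_rpow hr0.ne']
      · rw [← ofReal_pow, ← ofReal_mul, ← Real.rpow_natCast,
          ← Real.rpow_add (norm_pos_iff.2 h0)]
        congr 2
        push_cast
        ring
    · simp [hg0 x hx, hx, Real.zero_rpow hr0.ne']
  have key := h g hgm ⟨M ^ (r - 1), fun x => ?_⟩ hg0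
  swap
  · by_cases hx : x ∈ E
    · rw [hgn x hx]
      exact Real.rpow_le_rpow (norm_nonneg _) (hM x) (by linarith)
    · rw [hg0 x hx, norm_zero]
      positivity
  simp only [hgp, hgT] at key
  rw [integral_complex_ofReal, norm_real, Real.norm_of_nonneg (by positivity)] at key
  set A := ∫ x, ‖E.indicator T x‖ ^ r with hA
  have hA0 : 0 ≤ A := by positivity
  have hL : MemLp (E.indicator T) (ENNReal.ofReal r) volume := by
    rw [memLp_indicator_iff_restrict hE]
    have : IsFiniteMeasure (volume.restrict E) := isFiniteMeasure_restrict.2 hE'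
    exact MemLp.of_bound hT.aestronglyMeasurable M (ae_of_all _ hM)
  rw [hL.eLpNorm_eq_integral_rpow_norm (by simpa using hr0) ENNReal.ofReal_ne_top,
    ENNReal.toReal_ofReal hr0.le]
  refine ENNReal.ofReal_le_ofReal ?_
  rcases hA0.eq_or_lt with h0 | h0
  · rw [← hA, ← h0, Real.zero_rpow (by positivity)]
    exact hK
  · rw [← hA, show r⁻¹ = 1 - p⁻¹ by linarith, Real.rpow_sub h0, Real.rpow_one,
      div_le_iff₀ (by positivity)]
    exact key

theorem integrable_norm_rpow_of_bounded_support {g : ℝ → ℂ} {p N : ℝ} {E : Set ℝ} (hp : 0 < p)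
    (hE' : volume E ≠ ∞) (hgm : Measurable g) (hN : ∀ x, ‖g x‖ ≤ N) (hg0 : ∀ x ∉ E, g x = 0) :
    Integrable (fun x => ‖g x‖ ^ p) := by
  have hi : IntegrableOn (fun x => ‖g x‖ ^ p) E := by
    refine Measure.integrableOn_of_bounded (M := N ^ p) hE'
      (by fun_prop : Measurable fun x => ‖g x‖ ^ p).aestronglyMeasurable (ae_of_all _ fun x => ?_)
    rw [Real.norm_of_nonneg (by positivity)]
    exact Real.rpow_le_rpow (norm_nonneg _) (hN x) hp.le
  refine hi.integrable_of_forall_notMem_eq_zero fun x hx => ?_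
  rw [hg0 x hx, norm_zero, Real.zero_rpow hp.ne']

theorem SchwartzMap.integrable_norm_rpow (u : SchwartzMap ℝ ℂ) {p : ℝ} (hp : 0 < p) :
    Integrable (fun x => ‖u x‖ ^ p) := by
  have := (u.memLp (ENNReal.ofReal p) (μ := volume)).integrable_norm_rpow (by simpa using hp)
    ENNReal.ofReal_ne_top
  rwa [ENNReal.toReal_ofReal hp.le] at this

/-- The truncated propagator is bounded from `L^p` to `L^r`, locally in space. -/
theorem eLpNorm_indicator_truncatedPropagator_le {α t R r p : ℝ} (hα : α ∈ Set.Icc (0 : ℝ) 1)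
    (ht : t ≠ 0) (hR : 0 ≤ R) (hr : 2 ≤ r) (hp : r⁻¹ + p⁻¹ = 1) (u : SchwartzMap ℝ ℂ)
    {E : Set ℝ} (hE : MeasurableSet E) (hE' : volume E ≠ ∞) :
    eLpNorm (E.indicator (truncatedPropagator α t (1 - 2 / r) R u)) (ENNReal.ofReal r) volume ≤
      ENNReal.ofReal (420 * |t| ^ (-((1 + α) / 4) * (1 - 2 / r))) *
        eLpNorm u (ENNReal.ofReal p) volume := by
  have hr0 : 0 < r := by linarith
  have hri : r⁻¹ ≤ 2⁻¹ := inv_anti₀ (by norm_num) hr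
  have hp0 : 0 < p := inv_pos.1 (by linarith)
  have hθ0 : 0 ≤ 1 - 2 / r := by rw [sub_nonneg, div_le_one hr0]; exact hr
  have hθ1 : 1 - 2 / r ≤ 1 := by rw [sub_le_self_iff]; positivity
  have hθ : p / 2 * (1 + (1 - 2 / r)) = 1 := by
    field_simp
    field_simp at hp
    linarith
  rw [(u.memLp (ENNReal.ofReal p) volume).eLpNorm_eq_integral_rpow_norm (by simpa using hp0)
    ENNReal.ofReal_ne_top, ENNReal.toReal_ofReal hp0.le, ← ENNReal.ofReal_mul (by positivity)]
  refine eLpNorm_indicator_le_of_forall_bilinear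
    (continuous_truncatedPropagator hα hθ0 hθ1 u.integrable).measurable
    norm_truncatedPropagator_le (by positivity) hr hp hE hE' fun g hgm ⟨N, hN⟩ hg0 => ?_
  have hg := fun q (hq : 0 < q) => integrable_norm_rpow_of_bounded_support hq hE' hgm hN hg0
  have hgi : Integrable g := by
    rw [← integrable_norm_iff hgm.aestronglyMeasurable]
    simpa using hg 1 one_pos
  rw [integral_mul_truncatedPropagator hα hθ0 hθ1 u.integrable hgi]
  exact norm_integral_quarticMultiplier_le hα ht hR hp0 hθ0 hθ1 hθ u.continuous.measurable
    (u.integrable_norm_rpow (by positivity)) (u.integrable_norm_rpow hp0) hgm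
    (hg _ (by positivity)) (hg _ hp0)

open scoped FourierTransform in
theorem SchwartzMap.integrable_one_add_abs_mul_fourierInt (u : SchwartzMap ℝ ℂ) :
    Integrable (fun ξ => (1 + |ξ|) * ‖fourierInt u ξ‖) := by
  have h2 : (0 : ℝ) < 2 * Real.pi := by positivity
  have h : Integrable (fun η : ℝ => (1 + 2 * Real.pi * |η|) * ‖(𝓕 u : SchwartzMap ℝ ℂ) η‖) := by
    have h0 := (𝓕 u : SchwartzMap ℝ ℂ).integrable_pow_mul volume 0
    have h1 := ((𝓕 u : SchwartzMap ℝ ℂ).integrable_pow_mul volume 1).const_mul (2 * Real.pi)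
    refine (h0.add h1).congr (ae_of_all _ fun η => ?_)
    simp only [Pi.add_apply, pow_zero, pow_one, Real.norm_eq_abs]
    ring
  refine (h.comp_div h2.ne').congr (ae_of_all _ fun ξ => ?_)
  simp only [fourierInt_eq_fourier, SchwartzMap.fourier_coe]
  rw [abs_div, abs_of_pos h2, mul_div_cancel₀ _ h2.ne']

theorem quarticMultiplier_eq {α t θ ξ : ℝ} (hξ : ξ ≠ 0) :
    quarticMultiplier α t θ ξ = ((|ξ| ^ (α * θ) : ℝ) : ℂ) * cexp (I * (t * ξ ^ 4)) := by
  rw [quarticMultiplier, Real.rpow_def_of_pos (abs_pos.2 hξ), Real.log_abs]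
  push_cast
  ring_nf

theorem norm_quarticMultiplier_le {α t θ : ℝ} (hα : α ∈ Set.Icc (0 : ℝ) 1) (hθ0 : 0 ≤ θ)
    (hθ1 : θ ≤ 1) {ξ : ℝ} (hξ : ξ ≠ 0) : ‖quarticMultiplier α t θ ξ‖ ≤ 1 + |ξ| := by
  rw [norm_quarticMultiplier, ofReal_re, ← mul_assoc, mul_comm θ, ← Real.log_abs]
  exact exp_mul_log_le ⟨mul_nonneg hα.1 hθ0, mul_le_one₀ hα.2 hθ0 hθ1⟩
    ⟨by linarith [abs_pos.2 hξ], le_rfl⟩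

theorem DbihamGroup_eq (α t θ : ℝ) (u : ℝ → ℂ) (x : ℝ) : DbihamGroup (α * θ) t u x =
    (2 * Real.pi)⁻¹ * ∫ ξ, quarticMultiplier α t θ ξ * fourierInt u ξ *
      cexp (I * ((x * ξ : ℝ) : ℂ)) := by
  rw [DbihamGroup]
  congr 1
  refine integral_congr_ae ((Measure.ae_ne volume 0).mono fun ξ hξ => ?_)
  simp only [quarticMultiplier_eq hξ, mul_add, Complex.exp_add, ofReal_mul]
  ring

theorem tendsto_truncatedPropagator {α t θ : ℝ} (hα : α ∈ Set.Icc (0 : ℝ) 1) (hθ0 : 0 ≤ θ)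
    (hθ1 : θ ≤ 1) (u : SchwartzMap ℝ ℂ) (x : ℝ) :
    Filter.Tendsto (fun n : ℕ => truncatedPropagator α t θ n u x) Filter.atTop
      (nhds (∫ ξ, quarticMultiplier α t θ ξ * fourierInt u ξ * cexp (I * ((x * ξ : ℝ) : ℂ)))) := by
  refine (aecover_Ioc (μ := volume) (a := fun n : ℕ => -(n : ℝ)) (b := fun n : ℕ => (n : ℝ)) ?_
    ?_).integral_tendsto_of_countably_generated ?_
  · exact Filter.tendsto_neg_atTop_atBot.comp tendsto_natCast_atTop_atTop
  · exact tendsto_natCast_atTop_atTop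
  · refine u.integrable_one_add_abs_mul_fourierInt.mono' ?_
      ((Measure.ae_ne volume 0).mono fun ξ hξ => ?_)
    · exact ((measurable_quarticMultiplier α t θ).aestronglyMeasurable.mul
        (continuous_fourierInt u.integrable).aestronglyMeasurable).mul
        (by fun_prop : Continuous _).aestronglyMeasurable
    · rw [norm_mul, norm_mul, norm_exp_I_mul_ofReal, mul_one]
      gcongr
      exact norm_quarticMultiplier_le hα hθ0 hθ1 hξ

/-- Dispersive `L^{r'} → L^r` decay estimate:
`‖D^{α(1-2/r)} e^{it∂_x⁴} u₀‖_{L^r} ≤ C |t|^{-((1+α)/4)(1-2/r)} ‖u₀‖_{L^{r'}}`. -/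
theorem stmt_3 :
    ∀ r α : ℝ, 2 ≤ r → α ∈ Set.Icc (0:ℝ) 1 →
    ∃ C > (0:ℝ), ∀ r' : ℝ, 1/r + 1/r' = 1 →
      ∀ u₀ : SchwartzMap ℝ ℂ, ∀ t : ℝ, t ≠ 0 →
      eLpNorm (fun x : ℝ => DbihamGroup (α * (1 - 2/r)) t (fun y => u₀ y) x)
          (ENNReal.ofReal r) volume ≤
        ENNReal.ofReal (C * |t| ^ (-((1 + α)/4) * (1 - 2/r))) *
          eLpNorm (fun y : ℝ => u₀ y) (ENNReal.ofReal r') volume := by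
  intro r α hr hα
  refine ⟨420, by norm_num, fun p hp u t ht => ?_⟩
  rw [one_div, one_div] at hp
  have hr0 : 0 < r := by linarith
  have hθ0 : 0 ≤ 1 - 2 / r := by rw [sub_nonneg, div_le_one hr0]; exact hr
  have hθ1 : 1 - 2 / r ≤ 1 := by rw [sub_le_self_iff]; positivity
  have hlim : ∀ x, Filter.Tendsto (fun n : ℕ => (Set.Ioc (-(n : ℝ)) n).indicator
      (truncatedPropagator α t (1 - 2 / r) n u) x) Filter.atTop
      (nhds (∫ ξ, quarticMultiplier α t (1 - 2 / r : ℝ) ξ * fourierInt u ξ *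
        cexp (I * ((x * ξ : ℝ) : ℂ)))) := fun x => by
    refine (tendsto_truncatedPropagator hα hθ0 hθ1 u x).congr' ?_
    filter_upwards [Filter.eventually_gt_atTop ⌈|x|⌉₊] with n hn
    have hx := abs_lt.1 (Nat.lt_of_ceil_lt hn)
    rw [Set.indicator_of_mem (Set.mem_Ioc.2 ⟨hx.1, hx.2.le⟩)]
  calc _ ≤ eLpNorm (fun x => ∫ ξ, quarticMultiplier α t (1 - 2 / r : ℝ) ξ * fourierInt u ξ *
        cexp (I * ((x * ξ : ℝ) : ℂ))) (ENNReal.ofReal r) volume := by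
        refine eLpNorm_mono fun x => ?_
        rw [DbihamGroup_eq, norm_mul]
        refine mul_le_of_le_one_left (norm_nonneg _) ?_
        rw [norm_real, Real.norm_of_nonneg (by positivity)]
        refine inv_le_one_of_one_le₀ ?_
        linarith [Real.pi_gt_three]
    _ ≤ Filter.liminf (fun n : ℕ => eLpNorm ((Set.Ioc (-(n : ℝ)) n).indicator
          (truncatedPropagator α t (1 - 2 / r) n u)) (ENNReal.ofReal r) volume) Filter.atTop :=
        Lp.eLpNorm_lim_le_liminf_eLpNorm (fun n =>
          ((continuous_truncatedPropagator hα hθ0 hθ1 u.integrable).measurable.indicator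
            measurableSet_Ioc).aestronglyMeasurable) _ (ae_of_all _ hlim)
    _ ≤ _ := by
        refine Filter.liminf_le_of_le (by isBoundedDefault) fun b hb => ?_
        obtain ⟨n, hn⟩ := hb.exists
        exact hn.trans (eLpNorm_indicator_truncatedPropagator_le hα ht n.cast_nonneg hr hp u
          measurableSet_Ioc (by simp))
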